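/- arXiv:1005.4104 — 4 statements merged into one kernel-verified Lean document; each statement's English description precedes it below -/
import Mathlib

section
/- Fix a sequence of non-negative integers d_1, d_2, … with s_i = (Σ_{j=1}^i d_j) − (i−1) > 0 for all i ≥ 1. Consider the continuous-time random tree where the root dies immediately leaving d_1 alive offspring, each alive vertex lives an independent exponential rate-1 lifetime, and the i-th vertex to die leaves behind d_i alive offspring. For m ≥ 1, pick a vertex uniformly at random among all vertices alive just after the m-th death. Then: (a) the graph distance (generation) from the root to this vertex is distributed as Σ_{i=1}^m I_i, where I_1,…,I_m are independent Bernoulli random variables with P(I_i = 1) = d_i/s_i; and (b) the time A_m of the m-th death, which equals the weight of the shortest-weight path from the root to the m-th dying vertex, is distributed as Σ_{i=1}^m E_i/s_i, where E_1,…,E_m are i.i.d. rate-1 exponential random variables. -/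
open MeasureTheory ProbabilityTheory Filter Real
open scoped ENNReal NNReal

noncomputable section

/-- The exponential distribution with rate 1 on `ℝ`. -/
def expDist : Measure ℝ :=
  volume.withDensity (fun x => if 0 ≤ x then ENNReal.ofReal (Real.exp (-x)) else 0)

/-- The uniform distribution on `[0,1)`. -/
def uniform01 : Measure ℝ := volume.restrict (Set.Ico (0 : ℝ) 1)

/-- The Bernoulli distribution on `Bool` with success probability `p`. -/
def bernoulliDist (p : ℝ) : Measure Bool :=
  ENNReal.ofReal p • Measure.dirac true + ENNReal.ofReal (1 - p) • Measure.dirac false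

/-- The law of `Σ_{i=1}^m Iᵢ` for independent Bernoulli variables with `P(Iᵢ = 1) = ρ i`. -/
def bernoulliSumLaw (ρ : ℕ → ℝ) (m : ℕ) : Measure ℕ :=
  (Measure.pi (fun i : Fin m => bernoulliDist (ρ (i.1 + 1)))).map
    (fun x => (Finset.univ.filter (fun i => x i = true)).card)

/-- The law of `Σ_{i=1}^m Eᵢ/s(i)` for i.i.d. rate-1 exponential `E₁, …, E_m`. -/
def expWeightedSumLaw (s : ℕ → ℤ) (m : ℕ) : Measure ℝ :=
  (Measure.pi (fun _ : Fin m => expDist)).map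
    (fun e => ∑ i : Fin m, e i / ((s (i.1 + 1) : ℤ) : ℝ))

/-- The state of the continuous-time tree construction: the set of labels of alive vertices,
their birth times and generations, the number of labels used so far, and the time of the
last death.  Vertices are labelled `0, 1, 2, …` in order of birth (`0` is the root). -/
structure TreeState where
  alive : Finset ℕ
  birth : ℕ → ℝ
  gen : ℕ → ℕ
  used : ℕ
  time : ℝ

/-- Initial state: the root (label `0`, generation `0`) dies immediately at time `0`, leaving
alive its `d₁` offspring, labelled `1, …, d₁`, of generation `1`. -/
def initState (d₁ : ℕ) : TreeState where
  alive := Finset.Icc 1 d₁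
  birth := fun _ => 0
  gen := fun v => if v = 0 then 0 else 1
  used := d₁
  time := 0

/-- One step of the construction, given the lifetimes `ℓ` of the vertices: among the alive
vertices, the one whose death time `birth + lifetime` is minimal (ties broken by least label;
ties have probability zero) dies, leaving behind `dnext` newly born alive offspring. -/
def step (ℓ : ℕ → ℝ) (dnext : ℕ) (st : TreeState) : TreeState :=
  let t : ℝ := sInf ((fun v => st.birth v + ℓ v) '' (st.alive : Set ℕ))
  let v : ℕ := sInf {u : ℕ | u ∈ st.alive ∧ st.birth u + ℓ u = t}
  { alive := (st.alive.erase v) ∪ Finset.Ioc st.used (st.used + dnext)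
    birth := fun w => if st.used < w ∧ w ≤ st.used + dnext then t else st.birth w
    gen := fun w => if st.used < w ∧ w ≤ st.used + dnext then st.gen v + 1 else st.gen w
    used := st.used + dnext
    time := t }

/-- `states d ℓ m` is the state of the construction just after the `(m+1)`-st death (the
root, which dies immediately at time `0`, being the first vertex to die, and the `i`-th
dying vertex leaving behind `d i` offspring); its `time` field is the time of the `m`-th
death occurring after time `0`. -/
def states (d : ℕ → ℕ) (ℓ : ℕ → ℝ) : ℕ → TreeState
  | 0 => initState (d 1)
  | m + 1 => step ℓ (d (m + 2)) (states d ℓ m)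

/-- Uniform pick from a finite set of labels, driven by a uniform-[0,1) variable `u`. -/
def pickFrom (s : Finset ℕ) (u : ℝ) : ℕ :=
  (s.sort (· ≤ ·)).getD (⌊u * s.card⌋).toNat 0

lemma expDist_eq : expDist = volume.withDensity (exponentialPDF 1) := by
  unfold expDist
  congr 1
  ext x
  rw [exponentialPDF_eq]
  split_ifs <;> simp

instance : IsProbabilityMeasure expDist := by
  rw [expDist_eq]
  constructor
  rw [withDensity_apply _ MeasurableSet.univ, Measure.restrict_univ]
  exact lintegral_exponentialPDF_eq_one one_pos

instance : NullSingletonClass expDist := by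
  unfold expDist; infer_instance

lemma measurable_expDens :
    Measurable (fun x : ℝ => if 0 ≤ x then ENNReal.ofReal (Real.exp (-x)) else 0) := by
  refine Measurable.ite measurableSet_Ici (by fun_prop) (by fun_prop)

lemma lintegral_expDist {g : ℝ → ℝ≥0∞} (hg : Measurable g) :
    ∫⁻ x, g x ∂expDist =
      ∫⁻ x, (if 0 ≤ x then ENNReal.ofReal (Real.exp (-x)) else 0) * g x := by
  unfold expDist
  rw [lintegral_withDensity_eq_lintegral_mul _ measurable_expDens hg]
  rfl

lemma expDist_nonneg : ∀ᵐ x ∂expDist, 0 ≤ x := by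
  unfold expDist
  rw [ae_withDensity_iff measurable_expDens]
  filter_upwards with x hx
  by_contra h
  simp [h] at hx

lemma expDist_pos : ∀ᵐ x ∂expDist, 0 < x := by
  have h : ∀ᵐ x ∂expDist, x ≠ 0 := by
    simp [ae_iff]
  filter_upwards [h, expDist_nonneg] with x h1 h2
  exact lt_of_le_of_ne h2 (Ne.symm h1)

lemma expDist_shift {x : ℝ} (hx : 0 ≤ x) {t : Set ℝ} (ht : MeasurableSet t) :
    expDist {y | x < y ∧ y - x ∈ t} = ENNReal.ofReal (Real.exp (-x)) * expDist t := by
  have hm : MeasurableSet {y : ℝ | x < y ∧ y - x ∈ t} :=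
    measurableSet_Ioi.inter (ht.preimage (by fun_prop))
  have ht' : MeasurableSet {z : ℝ | 0 < z ∧ z ∈ t} := measurableSet_Ioi.inter ht
  have h1 : expDist t = expDist {z : ℝ | 0 < z ∧ z ∈ t} := by
    apply measure_congr
    filter_upwards [expDist_pos] with z hz
    apply propext
    show z ∈ t ↔ 0 < z ∧ z ∈ t
    simp [hz]
  rw [h1, ← lintegral_indicator_one hm, ← lintegral_indicator_one ht',
    lintegral_expDist (measurable_one.indicator hm),
    lintegral_expDist (measurable_one.indicator ht'),
    ← lintegral_const_mul _ (by exact measurable_expDens.mul (measurable_one.indicator ht'))]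
  conv_rhs => rw [← lintegral_sub_right_eq_self _ x]
  congr 1
  ext y
  by_cases hy : x < y ∧ y - x ∈ t
  · have h2 : 0 < y - x ∧ y - x ∈ t := ⟨by linarith [hy.1], hy.2⟩
    have h3 : (0:ℝ) ≤ y := by linarith [hy.1]
    rw [Set.indicator_of_mem (by exact hy), Set.indicator_of_mem (by exact h2), if_pos h3,
      if_pos h2.1.le]
    simp only [Pi.one_apply, mul_one]
    rw [← ENNReal.ofReal_mul (Real.exp_nonneg _), ← Real.exp_add]
    congr 2; ring
  · have h2 : ¬ (0 < y - x ∧ y - x ∈ t) := fun h => hy ⟨by linarith [h.1], h.2⟩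
    rw [Set.indicator_of_notMem (by exact hy), Set.indicator_of_notMem (by exact h2)]
    simp

lemma expDist_scale (n : ℕ) {g : ℝ → ℝ≥0∞} (hg : Measurable g) :
    ∫⁻ x, ENNReal.ofReal (Real.exp (-x)) ^ n * g x ∂expDist =
      ((n + 1 : ℕ) : ℝ≥0∞)⁻¹ * ∫⁻ e, g (e / ((n + 1 : ℕ) : ℝ)) ∂expDist := by
  have hN : (0 : ℝ) < ((n + 1 : ℕ) : ℝ) := by positivity
  have hm1 : Measurable fun x : ℝ => ENNReal.ofReal (Real.exp (-x)) ^ n * g x := by fun_prop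
  have hm2 : Measurable fun e : ℝ => g (e / ((n + 1 : ℕ) : ℝ)) := by fun_prop
  rw [lintegral_expDist hm1, lintegral_expDist hm2]
  conv_rhs => rw [← Real.smul_map_volume_mul_left hN.ne', lintegral_smul_measure]
  rw [lintegral_map (by exact measurable_expDens.mul hm2) (by fun_prop), abs_of_pos hN,
    ENNReal.ofReal_natCast, smul_eq_mul, ← mul_assoc, ENNReal.inv_mul_cancel (by simp) (by simp),
    one_mul]
  congr 1
  ext x
  rw [mul_div_cancel_left₀ _ hN.ne']
  by_cases hx : 0 ≤ x
  · rw [if_pos hx, if_pos (by positivity), ← mul_assoc, ← pow_succ', ← ENNReal.ofReal_pow (Real.exp_nonneg _),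
      ← Real.exp_nat_mul]
    congr 3
    ring
  · rw [if_neg hx, if_neg (by intro h; exact hx (nonneg_of_mul_nonneg_right h hN))]
    simp

section resample
variable {ι : Type*} [DecidableEq ι] (ν : ι → Measure ℝ) [∀ i, IsProbabilityMeasure (ν i)]

lemma resample (i : ι) :
    ((ν i).prod (Measure.infinitePi ν)).map (fun p : ℝ × (ι → ℝ) => Function.update p.2 i p.1)
      = Measure.infinitePi ν := by
  have hm : Measurable (fun p : ℝ × (ι → ℝ) => Function.update p.2 i p.1) := by
    rw [measurable_pi_iff]
    intro j
    by_cases h : j = i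
    · subst h; simpa using measurable_fst
    · simp only [Function.update_of_ne h]; fun_prop
  refine Measure.eq_infinitePi _ fun s t ht => ?_
  rw [Measure.map_apply hm (MeasurableSet.pi s.countable_toSet fun j _ => ht j)]
  have : (fun p : ℝ × (ι → ℝ) => Function.update p.2 i p.1) ⁻¹' (Set.pi s t)
      = (if i ∈ s then t i else Set.univ) ×ˢ (Set.pi (s.erase i : Finset ι) t) := by
    ext ⟨x, X⟩
    simp only [Set.mem_preimage, Set.mem_pi, Finset.mem_coe, Set.mem_prod, Finset.mem_erase]
    constructor
    · intro h
      constructor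
      · split_ifs with hi
        · simpa using h i hi
        · trivial
      · intro j hj
        simpa [hj.1] using h j hj.2
    · rintro ⟨h1, h2⟩ j hj
      by_cases hji : j = i
      · subst hji; simpa [hj] using h1
      · simpa [hji] using h2 j ⟨hji, hj⟩
  rw [this, Measure.prod_prod, Measure.infinitePi_pi _ (fun j _ => ht j)]
  by_cases hi : i ∈ s
  · rw [if_pos hi, Finset.mul_prod_erase s (fun j => ν j (t j)) hi]
  · rw [if_neg hi, measure_univ, one_mul, Finset.erase_eq_of_notMem hi]

lemma lintegral_resample (i : ι) {G : (ι → ℝ) → ℝ≥0∞} (hG : Measurable G) :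
    ∫⁻ X, G X ∂(Measure.infinitePi ν) =
      ∫⁻ x, ∫⁻ X, G (Function.update X i x) ∂(Measure.infinitePi ν) ∂(ν i) := by
  have hm : Measurable (fun p : ℝ × (ι → ℝ) => Function.update p.2 i p.1) := by
    rw [measurable_pi_iff]
    intro j
    by_cases h : j = i
    · subst h; simpa using measurable_fst
    · simp only [Function.update_of_ne h]; fun_prop
  conv_lhs => rw [← resample ν i]
  rw [lintegral_map hG hm, lintegral_prod _ (by exact (hG.comp hm).aemeasurable)]

end resample

/-- i.i.d. exponential lifetimes -/
def expPi : Measure (ℕ → ℝ) := Measure.infinitePi (fun _ : ℕ => expDist)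

instance : IsProbabilityMeasure expPi := by unfold expPi; infer_instance

def shiftBy (B : Finset ℕ) (x : ℝ) (X : ℕ → ℝ) : ℕ → ℝ := fun u => if u ∈ B then X u - x else X u

lemma measurable_shiftBy (B : Finset ℕ) :
    Measurable (fun p : ℝ × (ℕ → ℝ) => shiftBy B p.1 p.2) := by
  rw [measurable_pi_iff]
  intro u
  unfold shiftBy
  by_cases h : u ∈ B
  · simp only [h, if_true]; fun_prop
  · simp only [h, if_false]; fun_prop

lemma measurableSet_gt (B : Finset ℕ) (x : ℝ) : MeasurableSet {X : ℕ → ℝ | ∀ u ∈ B, x < X u} := by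
  have : {X : ℕ → ℝ | ∀ u ∈ B, x < X u} = Set.pi B (fun _ => Set.Ioi x) := by
    ext X; simp [Set.mem_pi]
  rw [this]
  exact MeasurableSet.pi B.countable_toSet fun _ _ => measurableSet_Ioi

lemma expPi_shift (B : Finset ℕ) {x : ℝ} (hx : 0 ≤ x) :
    (expPi.restrict {X | ∀ u ∈ B, x < X u}).map (shiftBy B x) =
      (ENNReal.ofReal (Real.exp (-x)) ^ B.card) • expPi := by
  have hm : Measurable (shiftBy B x) := (measurable_shiftBy B).comp (by fun_prop : Measurable fun X : ℕ → ℝ => (x, X))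
  set c := ENNReal.ofReal (Real.exp (-x)) ^ B.card with hc
  have hc0 : c ≠ 0 := by rw [hc]; exact pow_ne_zero _ (by simp [Real.exp_pos])
  have hct : c ≠ ⊤ := by rw [hc]; exact ENNReal.pow_ne_top (by simp)
  suffices h : c⁻¹ • (expPi.restrict {X | ∀ u ∈ B, x < X u}).map (shiftBy B x) = expPi by
    conv_rhs => rw [← h, smul_smul, ENNReal.mul_inv_cancel hc0 hct, one_smul]
  refine Measure.eq_infinitePi _ fun s t ht => ?_
  have hst : MeasurableSet (Set.pi (s : Set ℕ) t) := MeasurableSet.pi s.countable_toSet fun j _ => ht j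
  rw [Measure.smul_apply, Measure.map_apply hm hst, Measure.restrict_apply (hm hst)]
  have hset : shiftBy B x ⁻¹' (Set.pi s t) ∩ {X | ∀ u ∈ B, x < X u} =
      Set.pi (s ∪ B : Finset ℕ) (fun u => if u ∈ B then
        {y | x < y ∧ y - x ∈ (if u ∈ s then t u else Set.univ)} else t u) := by
    ext X
    simp only [Set.mem_inter_iff, Set.mem_preimage, Set.mem_pi, Finset.mem_coe, Finset.mem_union,
      Set.mem_ofPred_eq, shiftBy]
    constructor
    · rintro ⟨h1, h2⟩ u hu
      by_cases hB : u ∈ B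
      · rw [if_pos hB]
        refine ⟨h2 u hB, ?_⟩
        split_ifs with hus
        · simpa [hB] using h1 u hus
        · trivial
      · rw [if_neg hB]
        have := h1 u (hu.resolve_right hB)
        simpa [hB] using this
    · intro h
      constructor
      · intro u hu
        have := h u (Or.inl hu)
        by_cases hB : u ∈ B
        · simp only [hB, if_true, hu] at this ⊢; exact this.2
        · simpa [hB] using this
      · intro u hu
        have := h u (Or.inr hu)
        simp only [hu, if_true] at this; exact this.1
  have hmt : ∀ u, MeasurableSet (if u ∈ s then t u else Set.univ) := by
    intro u; split_ifs; exacts [ht u, MeasurableSet.univ]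
  rw [hset, expPi, Measure.infinitePi_pi]
  · have e1 : ∀ u ∈ s ∪ B, expDist (if u ∈ B then
        {y | x < y ∧ y - x ∈ (if u ∈ s then t u else Set.univ)} else t u) =
        (if u ∈ B then ENNReal.ofReal (Real.exp (-x)) else 1) *
          (if u ∈ s then expDist (t u) else 1) := by
      intro u hu
      by_cases hB : u ∈ B
      · simp only [hB, if_true]
        rw [expDist_shift hx (hmt u)]
        split_ifs <;> simp
      · have : u ∈ s := (Finset.mem_union.1 hu).resolve_right hB
        simp [hB, this]
    rw [Finset.prod_congr rfl e1, Finset.prod_mul_distrib]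
    have e2 : ∏ u ∈ s ∪ B, (if u ∈ B then ENNReal.ofReal (Real.exp (-x)) else 1) = c := by
      rw [Finset.prod_ite_mem, Finset.inter_eq_right.2 Finset.subset_union_right, Finset.prod_const]
    have e3 : ∏ u ∈ s ∪ B, (if u ∈ s then expDist (t u) else 1) = ∏ u ∈ s, expDist (t u) := by
      rw [Finset.prod_ite_mem, Finset.inter_eq_right.2 Finset.subset_union_left]
    rw [e2, e3, smul_eq_mul, ← mul_assoc, ENNReal.inv_mul_cancel hc0 hct, one_mul]
  · intro u hu
    split_ifs with hB h2
    · exact measurableSet_Ioi.inter ((ht u).preimage (by fun_prop))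
    · exact measurableSet_Ioi.inter (MeasurableSet.univ.preimage (by fun_prop : Measurable fun y : ℝ => y - x))
    · exact ht u

lemma lintegral_shift (B : Finset ℕ) {x : ℝ} (hx : 0 ≤ x) {G : (ℕ → ℝ) → ℝ≥0∞}
    (hG : Measurable G) :
    ∫⁻ X, {X | ∀ u ∈ B, x < X u}.indicator (fun X => G (shiftBy B x X)) X ∂expPi =
      ENNReal.ofReal (Real.exp (-x)) ^ B.card * ∫⁻ X, G X ∂expPi := by
  have hm : Measurable (shiftBy B x) := (measurable_shiftBy B).comp (by fun_prop : Measurable fun X : ℕ → ℝ => (x, X))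
  rw [lintegral_indicator (measurableSet_gt B x), ← lintegral_map hG hm, expPi_shift B hx,
    lintegral_smul_measure, smul_eq_mul]

lemma expPi_ne {u v : ℕ} (h : u ≠ v) : ∀ᵐ X ∂expPi, X u ≠ X v := by
  have hm : MeasurableSet {X : ℕ → ℝ | X u = X v} := measurableSet_eq_fun (by fun_prop) (by fun_prop)
  rw [ae_iff]
  simp only [ne_eq, not_not]
  have h2 := Measure.infinitePi_map_eval_prod (P := fun _ : ℕ => expDist) h
  have h3 : {X : ℕ → ℝ | X u = X v} = (fun X : ℕ → ℝ => (X u, X v)) ⁻¹' {p : ℝ × ℝ | p.1 = p.2} := rfl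
  have hd : MeasurableSet {p : ℝ × ℝ | p.1 = p.2} := measurableSet_eq_fun (by fun_prop) (by fun_prop)
  rw [h3, ← Measure.map_apply (by fun_prop) hd, expPi, h2, Measure.prod_apply hd]
  have : ∀ x : ℝ, Prod.mk x ⁻¹' {p : ℝ × ℝ | p.1 = p.2} = {x} := by
    intro x; ext y; simp [eq_comm]
  simp [this]

def TreeState.toT (st : TreeState) : Finset ℕ × (ℕ → ℝ) × (ℕ → ℕ) × ℕ × ℝ :=
  (st.alive, st.birth, st.gen, st.used, st.time)

instance : MeasurableSpace TreeState := MeasurableSpace.comap TreeState.toT inferInstance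

section meas
variable {Z : Type*} [MeasurableSpace Z]

lemma measurable_toT : Measurable TreeState.toT := comap_measurable _

lemma meas_alive : Measurable TreeState.alive := measurable_toT.fst
lemma meas_birth : Measurable TreeState.birth := measurable_toT.snd.fst
lemma meas_gen : Measurable TreeState.gen := measurable_toT.snd.snd.fst
lemma meas_used : Measurable TreeState.used := measurable_toT.snd.snd.snd.fst
lemma meas_time : Measurable TreeState.time := measurable_toT.snd.snd.snd.snd

lemma meas_mk {st : Z → TreeState} (h1 : Measurable fun z => (st z).alive)
    (h2 : ∀ v, Measurable fun z => (st z).birth v) (h3 : ∀ v, Measurable fun z => (st z).gen v)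
    (h4 : Measurable fun z => (st z).used) (h5 : Measurable fun z => (st z).time) :
    Measurable st := by
  refine measurable_comap_iff.2 ?_
  have h2' : Measurable fun z => (st z).birth := measurable_pi_iff.2 h2
  have h3' : Measurable fun z => (st z).gen := measurable_pi_iff.2 h3
  exact h1.prodMk (h2'.prodMk (h3'.prodMk (h4.prodMk h5)))

def stepT (ℓ : ℕ → ℝ) (st : TreeState) : ℝ :=
  sInf ((fun v => st.birth v + ℓ v) '' (st.alive : Set ℕ))

def stepV (ℓ : ℕ → ℝ) (st : TreeState) : ℕ :=
  sInf {u : ℕ | u ∈ st.alive ∧ st.birth u + ℓ u = stepT ℓ st}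

def nxt (dn : ℕ) (st : TreeState) (v : ℕ) (t : ℝ) : TreeState :=
  { alive := (st.alive.erase v) ∪ Finset.Ioc st.used (st.used + dn)
    birth := fun w => if st.used < w ∧ w ≤ st.used + dn then t else st.birth w
    gen := fun w => if st.used < w ∧ w ≤ st.used + dn then st.gen v + 1 else st.gen w
    used := st.used + dn
    time := t }

lemma step_eq (ℓ : ℕ → ℝ) (dn : ℕ) (st : TreeState) :
    step ℓ dn st = nxt dn st (stepV ℓ st) (stepT ℓ st) := rfl

lemma meas_gen_at {st : Z → TreeState} {v : Z → ℕ} (hst : Measurable st) (hv : Measurable v) :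
    Measurable fun z => (st z).gen (v z) := by
  have h : Measurable fun p : ℕ × Z => (st p.2).gen p.1 :=
    measurable_from_prod_countable_right fun n =>
      (measurable_pi_apply n).comp (meas_gen.comp hst)
  exact h.comp (hv.prodMk measurable_id)

lemma meas_nxt (dn : ℕ) {st : Z → TreeState} {v : Z → ℕ} {t : Z → ℝ} (hst : Measurable st)
    (hv : Measurable v) (ht : Measurable t) : Measurable fun z => nxt dn (st z) (v z) (t z) := by
  have hu : Measurable fun z => (st z).used := meas_used.comp hst
  have hset : ∀ w, MeasurableSet {z | (st z).used < w ∧ w ≤ (st z).used + dn} := fun w =>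
    hu (MeasurableSet.of_discrete (s := {k : ℕ | k < w ∧ w ≤ k + dn}))
  refine meas_mk ?_ ?_ ?_ ?_ ?_
  · have : Measurable fun p : Finset ℕ × ℕ × ℕ => p.1.erase p.2.1 ∪ Finset.Ioc p.2.2 (p.2.2 + dn) :=
      measurable_of_countable _
    exact this.comp ((meas_alive.comp hst).prodMk (hv.prodMk hu))
  · intro w
    exact Measurable.ite (hset w) ht ((measurable_pi_apply w).comp (meas_birth.comp hst))
  · intro w
    exact Measurable.ite (hset w) ((meas_gen_at hst hv).add_const 1)
      ((measurable_pi_apply w).comp (meas_gen.comp hst))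
  · exact hu.add_const dn
  · exact ht

lemma meas_stepT {ℓ : Z → ℕ → ℝ} {st : Z → TreeState} (hℓ : Measurable ℓ) (hst : Measurable st) :
    Measurable fun z => stepT (ℓ z) (st z) := by
  have h : ∀ A : Finset ℕ, Measurable fun z => ⨅ v : (A : Set ℕ), ((st z).birth v + ℓ z v) := by
    intro A
    refine Measurable.iInf fun v => ?_
    exact ((measurable_pi_apply _).comp (meas_birth.comp hst)).add ((measurable_pi_apply _).comp hℓ)
  have h2 : Measurable fun p : Finset ℕ × Z =>
      ⨅ v : (p.1 : Set ℕ), ((st p.2).birth v + ℓ p.2 v) :=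
    measurable_from_prod_countable_right h
  have h3 : Measurable fun z => ((st z).alive, z) := (meas_alive.comp hst).prodMk measurable_id
  have h4 := h2.comp h3
  unfold stepT
  simp only [sInf_image']
  exact h4

lemma meas_sInf_nat {p : ℕ → Z → Prop} (hp : ∀ n, MeasurableSet {z | p n z}) :
    Measurable fun z => sInf {n | p n z} := by
  classical
  refine measurable_to_countable' fun k => ?_
  have : (fun z => sInf {n | p n z}) ⁻¹' {k} =
      ({z | p k z} ∩ ⋂ j ∈ Finset.range k, {z | p j z}ᶜ) ∪
        ({_z | k = 0} ∩ ⋂ j, {z | p j z}ᶜ) := by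
    ext z
    simp only [Set.mem_preimage, Set.mem_singleton_iff, Set.mem_union, Set.mem_inter_iff,
      Set.mem_ofPred_eq, Set.mem_iInter, Set.mem_compl_iff, Finset.mem_range]
    constructor
    · rintro rfl
      by_cases hne : {n | p n z}.Nonempty
      · left
        exact ⟨Nat.sInf_mem hne, fun j hj => Nat.notMem_of_lt_sInf hj⟩
      · right
        rw [Set.not_nonempty_iff_eq_empty] at hne
        refine ⟨by rw [hne]; simp, fun j hj => ?_⟩
        have : j ∈ {n | p n z} := hj
        rw [hne] at this; exact this
    · rintro (⟨h1, h2⟩ | ⟨h1, h2⟩)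
      · refine le_antisymm (Nat.sInf_le h1) ?_
        by_contra hlt
        push Not at hlt
        exact h2 _ hlt (Nat.sInf_mem (s := {n | p n z}) ⟨k, h1⟩)
      · have : {n | p n z} = ∅ := by
          ext j; simpa using h2 j
        rw [this, h1]; simp
  rw [this]
  refine MeasurableSet.union ((hp k).inter ?_) ((MeasurableSet.const _).inter ?_)
  · exact Finset.measurableSet_biInter _ fun j _ => (hp j).compl
  · exact MeasurableSet.iInter fun j => (hp j).compl

lemma meas_stepV {ℓ : Z → ℕ → ℝ} {st : Z → TreeState} (hℓ : Measurable ℓ) (hst : Measurable st) :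
    Measurable fun z => stepV (ℓ z) (st z) := by
  refine meas_sInf_nat fun u => ?_
  refine MeasurableSet.inter (s₁ := {z | u ∈ (st z).alive}) ?_ ?_
  · exact (meas_alive.comp hst) (measurableSet_mem_finset u)
  · refine measurableSet_eq_fun ?_ (meas_stepT hℓ hst)
    exact ((measurable_pi_apply _).comp (meas_birth.comp hst)).add ((measurable_pi_apply _).comp hℓ)

lemma meas_step (dn : ℕ) {ℓ : Z → ℕ → ℝ} {st : Z → TreeState} (hℓ : Measurable ℓ)
    (hst : Measurable st) : Measurable fun z => step (ℓ z) dn (st z) := by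
  simp only [step_eq]
  exact meas_nxt dn hst (meas_stepV hℓ hst) (meas_stepT hℓ hst)

def iter (d : ℕ → ℕ) (ℓ : ℕ → ℝ) : ℕ → ℕ → TreeState → TreeState
  | _, 0, st => st
  | k, n + 1, st => iter d ℓ (k + 1) n (step ℓ (d (k + 2)) st)

lemma meas_iter (d : ℕ → ℕ) {ℓ : Z → ℕ → ℝ} (hℓ : Measurable ℓ) (n : ℕ) :
    ∀ (k : ℕ) {st : Z → TreeState} (_ : Measurable st),
      Measurable fun z => iter d (ℓ z) k n (st z) := by
  induction n with
  | zero => intro k st hst; exact hst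
  | succ n ih => intro k st hst; exact ih (k + 1) (meas_step _ hℓ hst)

lemma meas_pick : Measurable fun p : Finset ℕ × ℝ => pickFrom p.1 p.2 := by
  refine measurable_from_prod_countable_right fun A => ?_
  unfold pickFrom
  have h : Measurable fun z : ℤ => (A.sort (· ≤ ·)).getD z.toNat 0 := measurable_of_countable _
  exact h.comp (Int.measurable_floor.comp (by fun_prop))

end meas

lemma iter_states (d : ℕ → ℕ) (ℓ : ℕ → ℝ) (n : ℕ) :
    ∀ k, iter d ℓ k n (states d ℓ k) = states d ℓ (k + n) := by
  induction n with
  | zero => intro k; rfl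
  | succ n ih =>
    intro k
    show iter d ℓ (k + 1) n (states d ℓ (k + 1)) = _
    rw [ih (k + 1)]; congr 1; omega

/-- locality: only lifetimes of alive and future vertices matter -/
lemma step_congr {ℓ ℓ' : ℕ → ℝ} (dn : ℕ) {st : TreeState} (h : ∀ u ∈ st.alive, ℓ u = ℓ' u) :
    step ℓ dn st = step ℓ' dn st := by
  have hT : stepT ℓ st = stepT ℓ' st := by
    unfold stepT
    congr 1
    apply Set.image_congr
    intro u hu
    rw [h u hu]
  have hV : stepV ℓ st = stepV ℓ' st := by
    unfold stepV
    congr 1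
    ext u
    simp only [Set.mem_ofPred_eq]
    constructor
    · rintro ⟨h1, h2⟩; exact ⟨h1, by rw [← h u h1, ← hT, h2]⟩
    · rintro ⟨h1, h2⟩; exact ⟨h1, by rw [h u h1, hT, h2]⟩
  rw [step_eq, step_eq, hT, hV]

lemma iter_congr (d : ℕ → ℕ) {ℓ ℓ' : ℕ → ℝ} (n : ℕ) :
    ∀ (k : ℕ) {st : TreeState} (_ : ∀ u, u ∈ st.alive ∨ st.used < u → ℓ u = ℓ' u),
      iter d ℓ k n st = iter d ℓ' k n st := by
  induction n with
  | zero => intro k st _; rfl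
  | succ n ih =>
    intro k st h
    show iter d ℓ (k + 1) n (step ℓ _ st) = iter d ℓ' (k + 1) n (step ℓ' _ st)
    rw [← step_congr _ (fun u hu => h u (Or.inl hu))]
    refine ih (k + 1) fun u hu => h u ?_
    rw [step_eq] at hu
    simp only [nxt, Finset.mem_union, Finset.mem_erase, Finset.mem_Ioc] at hu
    rcases hu with (⟨_, h1⟩ | h1) | h1
    · exact Or.inl h1
    · exact Or.inr h1.1
    · right; omega

/-- offset turning residual lifetimes into lifetimes -/
def off (st : TreeState) : ℕ → ℝ := fun u => if u ∈ st.alive then st.time - st.birth u else 0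

lemma meas_off : Measurable off := by
  rw [measurable_pi_iff]
  intro u
  exact Measurable.ite (meas_alive (measurableSet_mem_finset u))
    (meas_time.sub ((measurable_pi_apply u).comp meas_birth)) measurable_const

lemma step_min {ℓ : ℕ → ℝ} (dn : ℕ) {st : TreeState} {X : ℕ → ℝ} {v : ℕ} (hv : v ∈ st.alive)
    (hℓ : ∀ u, ℓ u = X u + off st u) (h : ∀ u ∈ st.alive.erase v, X v < X u) :
    step ℓ dn st = nxt dn st v (st.time + X v) := by
  have e : ∀ u ∈ st.alive, st.birth u + ℓ u = st.time + X u := by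
    intro u hu; rw [hℓ, off, if_pos hu]; ring
  have hT : stepT ℓ st = st.time + X v := by
    unfold stepT
    refine IsLeast.csInf_eq ⟨⟨v, hv, e v hv⟩, ?_⟩
    rintro _ ⟨u, hu, rfl⟩
    show _ ≤ st.birth u + ℓ u
    rw [e u hu]
    by_cases huv : u = v
    · rw [huv]
    · linarith [h u (Finset.mem_erase.2 ⟨huv, hu⟩)]
  have hV : stepV ℓ st = v := by
    unfold stepV
    have : {u : ℕ | u ∈ st.alive ∧ st.birth u + ℓ u = stepT ℓ st} = {v} := by
      ext u
      simp only [Set.mem_ofPred_eq, Set.mem_singleton_iff]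
      constructor
      · rintro ⟨h1, h2⟩
        by_contra huv
        rw [e u h1, hT] at h2
        linarith [h u (Finset.mem_erase.2 ⟨huv, h1⟩)]
      · rintro rfl
        exact ⟨hv, by rw [e u hv, hT]⟩
    rw [this]; simp
  rw [step_eq, hT, hV]

def V (d : ℕ → ℕ) (f : TreeState → ℝ≥0∞) (k n : ℕ) (st : TreeState) : ℝ≥0∞ :=
  ∫⁻ X, f (iter d (fun u => X u + off st u) k n st) ∂expPi

def Hf (d : ℕ → ℕ) (f : TreeState → ℝ≥0∞) (k n : ℕ) (st : TreeState) (X : ℕ → ℝ) : ℝ≥0∞ :=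
  f (iter d (fun u => X u + off st u) k n st)

lemma meas_Hf (d : ℕ → ℕ) {f : TreeState → ℝ≥0∞} (hf : Measurable f) (k n : ℕ) {Z : Type*}
    [MeasurableSpace Z] {st : Z → TreeState} {X : Z → ℕ → ℝ} (hst : Measurable st)
    (hX : Measurable X) : Measurable fun z => Hf d f k n (st z) (X z) := by
  refine hf.comp (meas_iter d ?_ n k hst)
  rw [measurable_pi_iff]
  intro u
  exact ((measurable_pi_apply u).comp hX).add ((measurable_pi_apply u).comp (meas_off.comp hst))

lemma meas_V (d : ℕ → ℕ) {f : TreeState → ℝ≥0∞} (hf : Measurable f) (k n : ℕ) :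
    Measurable (V d f k n) := by
  have h : Measurable fun p : TreeState × (ℕ → ℝ) => Hf d f k n p.1 p.2 :=
    meas_Hf d hf k n measurable_fst measurable_snd
  exact h.lintegral_prod_right'

lemma Hf_congr (d : ℕ → ℕ) (f : TreeState → ℝ≥0∞) (k n : ℕ) (st : TreeState) {X Y : ℕ → ℝ}
    (h : ∀ u, u ∈ st.alive ∨ st.used < u → X u = Y u) : Hf d f k n st X = Hf d f k n st Y := by
  unfold Hf
  rw [iter_congr d n k (fun u hu => ?_)]
  rw [h u hu]

/-- the integrand on the event that `v` dies first -/
lemma Hf_step (d : ℕ → ℕ) (f : TreeState → ℝ≥0∞) (k n : ℕ) {st : TreeState}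
    (hu : ∀ u ∈ st.alive, u ≤ st.used) {X : ℕ → ℝ} {v : ℕ} (hv : v ∈ st.alive)
    (h : ∀ u ∈ st.alive.erase v, X v < X u) :
    Hf d f k (n + 1) st X =
      Hf d f (k + 1) n (nxt (d (k + 2)) st v (st.time + X v))
        (shiftBy (st.alive.erase v) (X v) X) := by
  unfold Hf
  show f (iter d _ (k + 1) n (step _ _ st)) = _
  rw [step_min (d (k + 2)) hv (fun u => rfl) h]
  rw [iter_congr d n (k + 1) (fun u hu' => ?_)]
  simp only [nxt, Finset.mem_union, Finset.mem_erase, Finset.mem_Ioc] at hu'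
  by_cases h1 : u ∈ st.alive.erase v
  · have h2 := (Finset.mem_erase.1 h1)
    have h3 := hu u h2.2
    have h4 : ¬ (st.used < u ∧ u ≤ st.used + d (k + 2)) := by omega
    simp only [shiftBy, off, nxt, h1, h2.2, Finset.mem_union, true_or, if_true, h4, if_false]
    ring
  · have h5 : st.used < u := by
      rcases hu' with (h2 | h2) | h2
      · exact absurd (Finset.mem_erase.2 h2) h1
      · exact h2.1
      · omega
    have h6 : u ∉ st.alive := fun hh => by have := hu u hh; omega
    by_cases h7 : u ≤ st.used + d (k + 2)
    · simp [shiftBy, off, nxt, h6, h5, h7]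
    · simp [shiftBy, off, nxt, h6, h5, h7]

lemma one_step (d : ℕ → ℕ) {f : TreeState → ℝ≥0∞} (hf : Measurable f) (k n : ℕ) {st : TreeState}
    (hA : st.alive.Nonempty) (hu : ∀ u ∈ st.alive, u ≤ st.used) :
    V d f k (n + 1) st = ∑ v ∈ st.alive, ∫⁻ x, ENNReal.ofReal (Real.exp (-x)) ^ (st.alive.card - 1) *
      V d f (k + 1) n (nxt (d (k + 2)) st v (st.time + x)) ∂expDist := by
  have hae : ∀ᵐ X ∂expPi, Hf d f k (n + 1) st X = ∑ v ∈ st.alive,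
      {X : ℕ → ℝ | ∀ u ∈ st.alive.erase v, X v < X u}.indicator (fun X =>
        Hf d f (k + 1) n (nxt (d (k + 2)) st v (st.time + X v))
          (shiftBy (st.alive.erase v) (X v) X)) X := by
    have hne : ∀ᵐ X ∂expPi, ∀ u v : ℕ, u ≠ v → X u ≠ X v := by
      rw [ae_all_iff]; intro u
      rw [ae_all_iff]; intro v
      by_cases h : u = v
      · simp [h]
      · filter_upwards [expPi_ne h] with X hX _ using hX
    filter_upwards [hne] with X hX
    obtain ⟨v, hv, hmin⟩ := st.alive.exists_min_image X hA
    have hv' : ∀ u ∈ st.alive.erase v, X v < X u := fun u hu => by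
      have h1 := Finset.mem_erase.1 hu
      exact lt_of_le_of_ne (hmin u h1.2) (hX v u h1.1.symm)
    rw [Finset.sum_eq_single v]
    · rw [Set.indicator_of_mem (by exact hv'), Hf_step d f k n hu hv hv']
    · intro w hw hwv
      refine Set.indicator_of_notMem (fun hmem => ?_) _
      have := hmem v (Finset.mem_erase.2 ⟨hwv.symm, hv⟩)
      exact absurd this (not_lt.2 (hmin w hw))
    · intro h; exact absurd hv h
  have hmE : ∀ v, MeasurableSet {X : ℕ → ℝ | ∀ u ∈ st.alive.erase v, X v < X u} := by
    intro v
    have : {X : ℕ → ℝ | ∀ u ∈ st.alive.erase v, X v < X u} =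
        ⋂ u ∈ st.alive.erase v, {X : ℕ → ℝ | X v < X u} := by ext X; simp
    rw [this]
    exact Finset.measurableSet_biInter _ fun u _ =>
      measurableSet_lt (measurable_pi_apply v) (measurable_pi_apply u)
  have hmn : ∀ v, Measurable fun x : ℝ => nxt (d (k + 2)) st v (st.time + x) := fun v =>
    meas_nxt _ measurable_const measurable_const (by fun_prop)
  have hms : ∀ v, Measurable fun X : ℕ → ℝ => shiftBy (st.alive.erase v) (X v) X := by
    intro v
    have h2 : Measurable fun X : ℕ → ℝ => (X v, X) := (measurable_pi_apply v).prodMk measurable_id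
    exact (measurable_shiftBy (st.alive.erase v)).comp h2
  have hmH : ∀ v, Measurable fun X : ℕ → ℝ =>
      Hf d f (k + 1) n (nxt (d (k + 2)) st v (st.time + X v))
        (shiftBy (st.alive.erase v) (X v) X) := fun v =>
    meas_Hf d hf _ _ ((hmn v).comp (measurable_pi_apply v)) (hms v)
  show ∫⁻ X, Hf d f k (n + 1) st X ∂expPi = _
  rw [lintegral_congr_ae hae, lintegral_finsetSum _ (fun v _ => (hmH v).indicator (hmE v))]
  refine Finset.sum_congr rfl fun v hv => ?_
  unfold expPi
  rw [lintegral_resample (fun _ : ℕ => expDist) v ((hmH v).indicator (hmE v))]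
  refine lintegral_congr_ae ?_
  filter_upwards [expDist_nonneg] with x hx
  have hG : Measurable (Hf d f (k + 1) n (nxt (d (k + 2)) st v (st.time + x))) :=
    meas_Hf d hf _ _ measurable_const measurable_id
  have := lintegral_shift (st.alive.erase v) hx hG
  rw [Finset.card_erase_of_mem hv] at this
  refine Eq.trans ?_ this
  refine lintegral_congr fun X => ?_
  have hiff : Function.update X v x ∈ {X : ℕ → ℝ | ∀ u ∈ st.alive.erase v, X v < X u} ↔
      X ∈ {X : ℕ → ℝ | ∀ u ∈ st.alive.erase v, x < X u} := by
    simp only [Set.mem_ofPred_eq, Function.update_self]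
    refine forall₂_congr fun u hu => ?_
    rw [Function.update_of_ne (Finset.mem_erase.1 hu).1]
  by_cases hX : X ∈ {X : ℕ → ℝ | ∀ u ∈ st.alive.erase v, x < X u}
  · rw [Set.indicator_of_mem (hiff.2 hX), Set.indicator_of_mem hX, Function.update_self]
    refine Hf_congr d f _ _ _ fun u huu => ?_
    have huv : u ≠ v := by
      rintro rfl
      have h1 := hu u hv
      simp only [nxt, Finset.mem_union, Finset.mem_erase, Finset.mem_Ioc] at huu
      rcases huu with (h2 | h2) | h2
      · exact h2.1 rfl
      · omega
      · omega
    simp [shiftBy, Function.update_of_ne huv]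
  · rw [Set.indicator_of_notMem (fun h => hX (hiff.1 h)), Set.indicator_of_notMem hX]

lemma one_step' (d : ℕ → ℕ) {f : TreeState → ℝ≥0∞} (hf : Measurable f) (k n : ℕ) {st : TreeState}
    (hA : st.alive.Nonempty) (hu : ∀ u ∈ st.alive, u ≤ st.used) :
    V d f k (n + 1) st = (st.alive.card : ℝ≥0∞)⁻¹ * ∑ v ∈ st.alive,
      ∫⁻ e, V d f (k + 1) n (nxt (d (k + 2)) st v (st.time + e / (st.alive.card : ℝ))) ∂expDist := by
  rw [one_step d hf k n hA hu, Finset.mul_sum]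
  refine Finset.sum_congr rfl fun v _ => ?_
  obtain ⟨N, hN⟩ : ∃ N, st.alive.card = N + 1 := ⟨st.alive.card - 1, by have := hA.card_pos; omega⟩
  have hm : Measurable fun x : ℝ => V d f (k + 1) n (nxt (d (k + 2)) st v (st.time + x)) :=
    (meas_V d hf _ _).comp (meas_nxt _ measurable_const measurable_const (by fun_prop))
  rw [hN, Nat.add_sub_cancel]
  exact expDist_scale N hm

lemma nxt_card {dn : ℕ} {st : TreeState} {v : ℕ} {t : ℝ} (hv : v ∈ st.alive)
    (hu : ∀ u ∈ st.alive, u ≤ st.used) : (nxt dn st v t).alive.card = st.alive.card - 1 + dn := by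
  simp only [nxt]
  rw [Finset.card_union_of_disjoint, Finset.card_erase_of_mem hv, Nat.card_Ioc]
  · omega
  · rw [Finset.disjoint_left]
    intro u h1 h2
    have := hu u (Finset.mem_erase.1 h1).2
    have := (Finset.mem_Ioc.1 h2).1
    omega

lemma nxt_used {dn : ℕ} {st : TreeState} {v : ℕ} {t : ℝ}
    (hu : ∀ u ∈ st.alive, u ≤ st.used) : ∀ u ∈ (nxt dn st v t).alive, u ≤ (nxt dn st v t).used := by
  intro u h
  simp only [nxt, Finset.mem_union, Finset.mem_erase, Finset.mem_Ioc] at h ⊢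
  rcases h with h | h
  · have := hu u h.2; omega
  · omega

lemma nxt_sum {dn : ℕ} {st : TreeState} {v : ℕ} {t : ℝ}
    (hu : ∀ u ∈ st.alive, u ≤ st.used) (h : ℕ → ℝ≥0∞) :
    ∑ u ∈ (nxt dn st v t).alive, h ((nxt dn st v t).gen u) =
      ∑ u ∈ st.alive.erase v, h (st.gen u) + dn * h (st.gen v + 1) := by
  simp only [nxt]
  rw [Finset.sum_union]
  · congr 1
    · refine Finset.sum_congr rfl fun u h1 => ?_
      have := hu u (Finset.mem_erase.1 h1).2
      rw [if_neg (by omega)]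
    · rw [Finset.sum_congr rfl (g := fun _ => h (st.gen v + 1))
        (fun u h1 => by rw [if_pos (Finset.mem_Ioc.1 h1)])]
      simp
  · rw [Finset.disjoint_left]
    intro u h1 h2
    have := hu u (Finset.mem_erase.1 h1).2
    have := (Finset.mem_Ioc.1 h2).1
    omega

lemma lintegral_pi_succ {α : Type} [MeasurableSpace α] {n : ℕ} (ν : Fin (n + 1) → Measure α)
    [∀ i, SigmaFinite (ν i)] {G : (Fin (n + 1) → α) → ℝ≥0∞} (hG : Measurable G) :
    ∫⁻ x, G x ∂(Measure.pi ν) =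
      ∫⁻ a, ∫⁻ y, G (Fin.cons a y) ∂(Measure.pi fun j : Fin n => ν j.succ) ∂(ν 0) := by
  have h := (measurePreserving_piFinSuccAbove ν 0).symm
  rw [← h.lintegral_comp hG, lintegral_prod _ (by exact (hG.comp h.measurable).aemeasurable)]
  simp [MeasurableEquiv.piFinSuccAbove, Fin.insertNthEquiv]

def Tlaw (s : ℕ → ℤ) (k n : ℕ) (φ : ℝ → ℝ≥0∞) (t : ℝ) : ℝ≥0∞ :=
  ∫⁻ e, φ (t + ∑ i : Fin n, e i / ((s (i.1 + k) : ℤ) : ℝ)) ∂(Measure.pi fun _ : Fin n => expDist)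

lemma Tlaw_zero (s : ℕ → ℤ) (k : ℕ) (φ : ℝ → ℝ≥0∞) (t : ℝ) : Tlaw s k 0 φ t = φ t := by
  simp [Tlaw]

lemma Tlaw_succ (s : ℕ → ℤ) (k n : ℕ) {φ : ℝ → ℝ≥0∞} (hφ : Measurable φ) (t : ℝ) :
    Tlaw s k (n + 1) φ t = ∫⁻ e, Tlaw s (k + 1) n φ (t + e / ((s k : ℤ) : ℝ)) ∂expDist := by
  unfold Tlaw
  rw [lintegral_pi_succ (fun _ : Fin (n + 1) => expDist) (by exact hφ.comp (by fun_prop))]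
  refine lintegral_congr fun a => lintegral_congr fun y => ?_
  rw [Fin.sum_univ_succ]
  simp only [Fin.cons_zero, Fin.cons_succ, Fin.val_zero, Fin.val_succ, zero_add]
  congr 1
  rw [← add_assoc]
  congr 1
  refine Finset.sum_congr rfl fun i _ => ?_
  rw [show (i : ℕ) + 1 + k = i + (k + 1) by omega]

instance (p : ℝ) : IsFiniteMeasure (bernoulliDist p) := by
  constructor
  simp [bernoulliDist]

def Blaw (ρ : ℕ → ℝ) (k n : ℕ) (φ : ℕ → ℝ≥0∞) (g : ℕ) : ℝ≥0∞ :=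
  ∫⁻ x, φ (g + (Finset.univ.filter (fun i => x i = true)).card)
    ∂(Measure.pi fun i : Fin n => bernoulliDist (ρ (i.1 + k)))

lemma Blaw_zero (ρ : ℕ → ℝ) (k : ℕ) (φ : ℕ → ℝ≥0∞) (g : ℕ) : Blaw ρ k 0 φ g = φ g := by
  simp [Blaw]

lemma Blaw_succ (ρ : ℕ → ℝ) (k n : ℕ) (φ : ℕ → ℝ≥0∞) (g : ℕ) :
    Blaw ρ k (n + 1) φ g = ENNReal.ofReal (ρ k) * Blaw ρ (k + 1) n φ (g + 1) +
      ENNReal.ofReal (1 - ρ k) * Blaw ρ (k + 1) n φ g := by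
  unfold Blaw
  rw [lintegral_pi_succ (fun i : Fin (n + 1) => bernoulliDist (ρ (i.1 + k))) (measurable_of_countable _)]
  have e : ∀ (a : Bool) (y : Fin n → Bool), (Finset.univ.filter
      (fun i => (Fin.cons a y : Fin (n + 1) → Bool) i = true)).card =
      (if a = true then 1 else 0) + (Finset.univ.filter (fun i => y i = true)).card := by
    intro a y
    rw [Finset.card_filter, Finset.card_filter, Fin.sum_univ_succ]
    simp only [Fin.cons_zero, Fin.cons_succ]
  have e2 : (fun j : Fin n => bernoulliDist (ρ ((j.succ : Fin (n + 1)).1 + k))) =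
      fun j : Fin n => bernoulliDist (ρ (j.1 + (k + 1))) := by
    funext j
    rw [Fin.val_succ, show (j : ℕ) + 1 + k = j + (k + 1) by omega]
  simp only [e]
  rw [e2]
  simp only [Fin.val_zero, zero_add]
  conv_lhs => rw [bernoulliDist]
  rw [lintegral_add_measure, lintegral_smul_measure, lintegral_smul_measure, lintegral_dirac,
    lintegral_dirac]
  simp [add_assoc]

lemma s_rec {d : ℕ → ℕ} {s : ℕ → ℤ}
    (hs : ∀ i, s i = (∑ j ∈ Finset.Icc 1 i, (d j : ℤ)) - ((i : ℤ) - 1)) (k : ℕ) :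
    s (k + 2) = s (k + 1) - 1 + d (k + 2) := by
  rw [hs, hs, Finset.sum_Icc_succ_top (by omega)]
  push_cast
  ring

lemma V_time {d : ℕ → ℕ} {s : ℕ → ℤ}
    (hs : ∀ i, s i = (∑ j ∈ Finset.Icc 1 i, (d j : ℤ)) - ((i : ℤ) - 1))
    (hpos : ∀ i, 1 ≤ i → 0 < s i) {φ : ℝ → ℝ≥0∞} (hφ : Measurable φ) (n : ℕ) :
    ∀ (k : ℕ) (st : TreeState) (_ : (st.alive.card : ℤ) = s (k + 1))
      (_ : ∀ u ∈ st.alive, u ≤ st.used),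
      V d (fun st => φ st.time) k n st = Tlaw s (k + 1) n φ st.time := by
  induction n with
  | zero => intro k st _ _; rw [Tlaw_zero]; simp [V, iter]
  | succ n ih =>
    intro k st hc hu
    have hp := hpos (k + 1) (by omega)
    have hcpos : 0 < st.alive.card := by omega
    rw [one_step' d (f := fun st => φ st.time) (hφ.comp meas_time) k n (Finset.card_pos.1 hcpos) hu, Tlaw_succ s _ _ hφ]
    have e : ∀ v ∈ st.alive, ∫⁻ e, V d (fun st => φ st.time) (k + 1) n
        (nxt (d (k + 2)) st v (st.time + e / (st.alive.card : ℝ))) ∂expDist =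
        ∫⁻ e, Tlaw s (k + 1 + 1) n φ (st.time + e / ((s (k + 1) : ℤ) : ℝ)) ∂expDist := by
      intro v hv
      refine lintegral_congr fun e => ?_
      rw [ih (k + 1) _ _ (nxt_used hu)]
      · simp only [nxt]
        rw [← hc]; simp
      · rw [nxt_card hv hu, s_rec hs k, ← hc]; omega
    rw [Finset.sum_congr rfl e, Finset.sum_const, nsmul_eq_mul, ← mul_assoc,
      ENNReal.inv_mul_cancel (by simpa using hcpos.ne') (by simp), one_mul]

lemma list_sum_getD (g : ℕ → ℝ≥0∞) (l : List ℕ) :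
    ∑ j ∈ Finset.range l.length, g (l.getD j 0) = (l.map g).sum := by
  induction l with
  | nil => simp
  | cons a l ih =>
    rw [List.length_cons, Finset.sum_range_succ']
    simp only [List.getD_cons_succ, List.getD_cons_zero, List.map_cons, List.sum_cons]
    rw [ih, add_comm]

lemma uniform_floor (N : ℕ) (hN : 0 < N) (h : ℕ → ℝ≥0∞) :
    ∫⁻ u, h (⌊u * (N : ℝ)⌋).toNat ∂uniform01 = (N : ℝ≥0∞)⁻¹ * ∑ j ∈ Finset.range N, h j := by
  have hN' : (0 : ℝ) < N := by exact_mod_cast hN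
  have hU : Set.Ico (0 : ℝ) 1 = ⋃ j ∈ Finset.range N, Set.Ico ((j : ℝ) / N) ((j + 1 : ℝ) / N) := by
    ext u
    simp only [Set.mem_Ico, Set.mem_iUnion, Finset.mem_range, exists_prop]
    constructor
    · rintro ⟨h0, h1⟩
      have hnn : 0 ≤ u * N := by positivity
      refine ⟨⌊u * N⌋₊, ?_, ?_, ?_⟩
      · rw [Nat.floor_lt hnn]; nlinarith
      · rw [div_le_iff₀ hN']; exact Nat.floor_le hnn
      · rw [lt_div_iff₀ hN']; exact Nat.lt_floor_add_one _
    · rintro ⟨j, hj, h0, h1⟩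
      have hj' : (j : ℝ) + 1 ≤ N := by exact_mod_cast hj
      refine ⟨le_trans (by positivity) h0, lt_of_lt_of_le h1 ?_⟩
      rw [div_le_one hN']; exact hj'
  have key : ∀ (j : ℕ) (u : ℝ), u ∈ Set.Ico ((j : ℝ) / N) ((j + 1 : ℝ) / N) →
      (⌊u * (N : ℝ)⌋).toNat = j := by
    intro j u hu
    have h1 := (div_le_iff₀ hN').1 hu.1
    have h2 := (lt_div_iff₀ hN').1 hu.2
    have : ⌊u * (N : ℝ)⌋ = (j : ℤ) := by
      rw [Int.floor_eq_iff]; push_cast; exact ⟨h1, h2⟩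
    rw [this]; simp
  unfold uniform01
  rw [hU, lintegral_biUnion_finset]
  · rw [Finset.mul_sum]
    refine Finset.sum_congr rfl fun j _ => ?_
    rw [setLIntegral_congr_fun measurableSet_Ico (g := fun _ => h j)
      (fun u hu => by simp only [key j u hu])]
    rw [setLIntegral_const, Real.volume_Ico, ← sub_div, add_sub_cancel_left, one_div,
      ENNReal.ofReal_inv_of_pos hN', ENNReal.ofReal_natCast, mul_comm]
  · intro i _ j _ hij
    rw [Function.onFun, Set.disjoint_left]
    intro u h1 h2
    exact hij ((key i u h1).symm.trans (key j u h2))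
  · intro j _; exact measurableSet_Ico

lemma uniform_pick (A : Finset ℕ) (hA : A.Nonempty) (g : ℕ → ℝ≥0∞) :
    ∫⁻ u, g (pickFrom A u) ∂uniform01 = (A.card : ℝ≥0∞)⁻¹ * ∑ v ∈ A, g v := by
  unfold pickFrom
  rw [uniform_floor A.card hA.card_pos (fun j => g ((A.sort (· ≤ ·)).getD j 0))]
  congr 1
  have h := list_sum_getD g (A.sort (· ≤ ·))
  rw [Finset.length_sort] at h
  rw [h, Finset.sum, ← Finset.sort_eq A (· ≤ ·), Multiset.map_coe, Multiset.sum_coe]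

def fpick (φ : ℕ → ℝ≥0∞) (st : TreeState) : ℝ≥0∞ :=
  ∫⁻ u, φ (st.gen (pickFrom st.alive u)) ∂uniform01

instance : IsFiniteMeasure uniform01 := by
  unfold uniform01
  constructor; simp

lemma meas_genpick : Measurable fun p : TreeState × ℝ => p.1.gen (pickFrom p.1.alive p.2) :=
  meas_gen_at measurable_fst (meas_pick.comp ((meas_alive.comp measurable_fst).prodMk measurable_snd))

lemma meas_fpick (φ : ℕ → ℝ≥0∞) : Measurable (fpick φ) := by
  have h : Measurable fun p : TreeState × ℝ => φ (p.1.gen (pickFrom p.1.alive p.2)) :=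
    (measurable_of_countable φ).comp meas_genpick
  exact h.lintegral_prod_right'

lemma sum_erase_sum (A : Finset ℕ) (h : ℕ → ℝ≥0∞) :
    ∑ v ∈ A, ∑ u ∈ A.erase v, h u = ((A.card - 1 : ℕ) : ℝ≥0∞) * ∑ u ∈ A, h u := by
  have : ∑ v ∈ A, ∑ u ∈ A.erase v, h u = ∑ u ∈ A, ∑ v ∈ A.erase u, h u := by
    refine Finset.sum_comm' ?_
    intro x y
    simp only [Finset.mem_erase]
    tauto
  rw [this, Finset.mul_sum]
  refine Finset.sum_congr rfl fun u hu => ?_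
  rw [Finset.sum_const, Finset.card_erase_of_mem hu, nsmul_eq_mul]

lemma V_gen {d : ℕ → ℕ} {s : ℕ → ℤ}
    (hs : ∀ i, s i = (∑ j ∈ Finset.Icc 1 i, (d j : ℤ)) - ((i : ℤ) - 1))
    (hpos : ∀ i, 1 ≤ i → 0 < s i) (φ : ℕ → ℝ≥0∞) (n : ℕ) :
    ∀ (k : ℕ) (st : TreeState) (_ : (st.alive.card : ℤ) = s (k + 1))
      (_ : ∀ u ∈ st.alive, u ≤ st.used),
      V d (fpick φ) k n st = (st.alive.card : ℝ≥0∞)⁻¹ *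
        ∑ v ∈ st.alive, Blaw (fun i => (d i : ℝ) / ((s i : ℤ) : ℝ)) (k + 2) n φ (st.gen v) := by
  induction n with
  | zero =>
    intro k st hc _
    have hp := hpos (k + 1) (by omega)
    have hcpos : 0 < st.alive.card := by omega
    simp only [Blaw_zero]
    rw [← uniform_pick st.alive (Finset.card_pos.1 hcpos) (fun v => φ (st.gen v))]
    simp [V, iter, fpick]
  | succ n ih =>
    intro k st hc hu
    have hp := hpos (k + 1) (by omega)
    have hcpos : 0 < st.alive.card := by omega
    rw [one_step' d (meas_fpick φ) k n (Finset.card_pos.1 hcpos) hu]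
    congr 1
    set N := st.alive.card with hN
    set dn := d (k + 2) with hdn
    have hs2 : s (k + 2) = ((N - 1 + dn : ℕ) : ℤ) := by rw [s_rec hs k, ← hc]; omega
    have hp2 := hpos (k + 2) (by omega)
    have hN2 : 0 < N - 1 + dn := by omega
    set B := Blaw (fun i => (d i : ℝ) / ((s i : ℤ) : ℝ)) (k + 1 + 2) n φ with hB
    have e : ∀ v ∈ st.alive, ∫⁻ e, V d (fpick φ) (k + 1) n
        (nxt dn st v (st.time + e / (N : ℝ))) ∂expDist =
        ((N - 1 + dn : ℕ) : ℝ≥0∞)⁻¹ *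
          (∑ u ∈ st.alive.erase v, B (st.gen u) + dn * B (st.gen v + 1)) := by
      intro v hv
      rw [lintegral_congr (g := fun _ => ((N - 1 + dn : ℕ) : ℝ≥0∞)⁻¹ *
          (∑ u ∈ st.alive.erase v, B (st.gen u) + dn * B (st.gen v + 1)))]
      · simp
      · intro e
        rw [ih (k + 1) _ _ (nxt_used hu), nxt_card hv hu, nxt_sum hu]
        rw [nxt_card hv hu, show k + 1 + 1 = k + 2 from rfl, hs2]
    rw [Finset.sum_congr rfl e, ← Finset.mul_sum, Finset.sum_add_distrib,
      sum_erase_sum st.alive (fun u => B (st.gen u)), ← Finset.mul_sum]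
    simp only [Blaw_succ]
    rw [Finset.sum_add_distrib, ← Finset.mul_sum, ← Finset.mul_sum]
    have hNr : (0 : ℝ) < ((N - 1 + dn : ℕ) : ℝ) := by exact_mod_cast hN2
    have p1 : ENNReal.ofReal ((d (k + 2) : ℝ) / ((s (k + 2) : ℤ) : ℝ)) =
        ((N - 1 + dn : ℕ) : ℝ≥0∞)⁻¹ * dn := by
      rw [hs2, Int.cast_natCast, ENNReal.ofReal_div_of_pos hNr, ENNReal.ofReal_natCast,
        ENNReal.ofReal_natCast, ENNReal.div_eq_inv_mul]
    have p2 : ENNReal.ofReal (1 - (d (k + 2) : ℝ) / ((s (k + 2) : ℤ) : ℝ)) =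
        ((N - 1 + dn : ℕ) : ℝ≥0∞)⁻¹ * ((N - 1 : ℕ) : ℝ≥0∞) := by
      have : (1 - (d (k + 2) : ℝ) / ((s (k + 2) : ℤ) : ℝ)) =
          ((N - 1 : ℕ) : ℝ) / ((N - 1 + dn : ℕ) : ℝ) := by
        rw [hs2, Int.cast_natCast, eq_div_iff hNr.ne', sub_mul, div_mul_cancel₀ _ hNr.ne', ← hdn]
        push_cast; ring
      rw [this, ENNReal.ofReal_div_of_pos hNr, ENNReal.ofReal_natCast,
        ENNReal.ofReal_natCast, ENNReal.div_eq_inv_mul]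
    rw [p1, p2, mul_add, mul_assoc, mul_assoc, add_comm]

/-- **Shortest-weight paths on a tree** (Proposition 3.1 of
Bhamidi–van der Hofstad–Hooghiemstra, after Bühler): fix offspring numbers `d₁, d₂, …` with
`sᵢ = Σ_{j≤i} d_j - (i-1) > 0` for all `i ≥ 1`, and run the continuous-time construction
with i.i.d. rate-1 exponential lifetimes (`F (some v)` is the lifetime of the vertex with
label `v`; `F none` is an independent uniform variable used for the uniform pick).  Then,
for every `m ≥ 1`:
(a) the generation of a uniformly picked vertex among those alive just after the `m`-th
    death is distributed as `Σ_{i=1}^m Iᵢ` with `I₁, …, I_m` independent Bernoulli and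
    `P(Iᵢ = 1) = dᵢ/sᵢ`;
(b) the time `A_m` of the `m`-th death after time `0` (the root dies immediately at time
    `0`), which equals the weight of the shortest-weight path from the root to the `m`-th
    dying vertex, is distributed as `Σ_{i=1}^m Eᵢ/sᵢ` with `E₁, …, E_m` i.i.d. rate-1
    exponential. -/
theorem tree_fpp_generation_and_weight
    (d : ℕ → ℕ) (s : ℕ → ℤ)
    (hs : ∀ i, s i = (∑ j ∈ Finset.Icc 1 i, (d j : ℤ)) - ((i : ℤ) - 1))
    (hpos : ∀ i, 1 ≤ i → 0 < s i)
    (Ω : Type) [MeasurableSpace Ω] (μ : Measure Ω) [IsProbabilityMeasure μ]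
    (F : Option ℕ → Ω → ℝ)
    (hmeas : ∀ j, Measurable (F j))
    (hindep : iIndepFun F μ)
    (hU : μ.map (F none) = uniform01)
    (hL : ∀ v, μ.map (F (some v)) = expDist) :
    ∀ m : ℕ, 1 ≤ m →
      -- (a): generation of a uniform pick among the vertices alive just after the m-th death
      (μ.map (fun ω =>
          (states d (fun v => F (some v) ω) (m - 1)).gen
            (pickFrom (states d (fun v => F (some v) ω) (m - 1)).alive (F none ω)))
        = bernoulliSumLaw (fun i => (d i : ℝ) / ((s i : ℤ) : ℝ)) m)
      ∧
      -- (b): the time of the m-th death after time 0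
      (μ.map (fun ω => (states d (fun v => F (some v) ω) m).time)
        = expWeightedSumLaw s m) := by
  intro m hm
  have hlaw : μ.map (fun ω v => F (some v) ω) = expPi := by
    have h := (hindep.precomp (Option.some_injective ℕ)).map_fun_eq_infinitePi_map
      (fun v => hmeas (some v))
    rw [h, expPi]
    simp only [hL]
  have hmS : Measurable fun ω => (fun v => F (some v) ω) := measurable_pi_iff.2 fun v => hmeas _
  have hc1 : (((initState (d 1)).alive.card : ℕ) : ℤ) = s (0 + 1) := by
    rw [hs]; simp [initState]
  have hd1 : s 1 = (d 1 : ℤ) := by rw [hs]; simp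
  have hu1 : ∀ u ∈ (initState (d 1)).alive, u ≤ (initState (d 1)).used := by
    intro u hu; exact (Finset.mem_Icc.1 hu).2
  have hoff : ∀ (X : ℕ → ℝ) (n : ℕ),
      iter d (fun u => X u + off (initState (d 1)) u) 0 n (initState (d 1)) = states d X n := by
    intro X n
    have h0 : (fun u => X u + off (initState (d 1)) u) = X := by
      funext u; simp [off, initState]
    rw [h0]
    have := iter_states d X n 0
    rw [zero_add] at this
    exact this
  have hmst : ∀ n, Measurable fun X : ℕ → ℝ => states d X n := by
    intro n
    have := meas_iter d (measurable_id (α := ℕ → ℝ)) n 0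
      (measurable_const (a := initState (d 1)))
    have e : (fun X : ℕ → ℝ => states d X n) = fun X => iter d (id X) 0 n (initState (d 1)) := by
      funext X
      have := iter_states d X n 0
      rw [zero_add] at this
      exact this.symm
    rw [e]; exact this
  constructor
  · obtain ⟨n, rfl⟩ : ∃ n, m = n + 1 := ⟨m - 1, by omega⟩
    rw [Nat.add_sub_cancel]
    have hmg : Measurable fun p : ℝ × (ℕ → ℝ) =>
        (states d p.2 n).gen (pickFrom (states d p.2 n).alive p.1) :=
      meas_genpick.comp (((hmst n).comp measurable_snd).prodMk measurable_fst)
    refine Measure.ext_of_lintegral _ fun φ hφ => ?_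
    rw [lintegral_map hφ (by exact hmg.comp ((hmeas none).prodMk hmS))]
    have hmf : Measurable fun ω => (fun j => F j ω) := measurable_pi_iff.2 hmeas
    have : ∀ j, IsProbabilityMeasure (μ.map (F j)) := fun j =>
      Measure.isProbabilityMeasure_map (hmeas j).aemeasurable
    have hmΦ : Measurable fun p : ℝ × (ℕ → ℝ) =>
        φ ((states d p.2 n).gen (pickFrom (states d p.2 n).alive p.1)) := hφ.comp hmg
    have hmY : Measurable fun Y : Option ℕ → ℝ => (fun v => Y (some v)) :=
      measurable_pi_iff.2 fun v => measurable_pi_apply _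
    have hmG : Measurable fun Y : Option ℕ → ℝ =>
        φ ((states d (fun v => Y (some v)) n).gen
          (pickFrom (states d (fun v => Y (some v)) n).alive (Y none))) :=
      hmΦ.comp ((measurable_pi_apply none).prodMk hmY)
    have hjoint := hindep.map_fun_eq_infinitePi_map hmeas
    have hsome : (Measure.infinitePi (fun j => μ.map (F j))).map (fun Y v => Y (some v)) = expPi := by
      rw [Measure.map_infinitePi_infinitePi_of_inj (Option.some_injective ℕ), expPi]
      simp only [hL]
    have e1 : ∫⁻ ω, φ ((states d (fun v => F (some v) ω) n).gen
          (pickFrom (states d (fun v => F (some v) ω) n).alive (F none ω))) ∂μ =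
        ∫⁻ u, ∫⁻ X, φ ((states d X n).gen (pickFrom (states d X n).alive u)) ∂expPi ∂uniform01 := by
      rw [← lintegral_map (μ := μ) (g := fun ω => (fun j => F j ω)) hmG hmf, hjoint,
        lintegral_resample (fun j => μ.map (F j)) none hmG, hU]
      refine lintegral_congr fun u => ?_
      simp only [Function.update_self, ne_eq, reduceCtorEq, not_false_eq_true,
        Function.update_of_ne]
      rw [← hsome, lintegral_map (by exact hmΦ.comp (measurable_const.prodMk measurable_id)) hmY]
    rw [e1, lintegral_lintegral_swap hmΦ.aemeasurable]
    have e2 : ∫⁻ X, ∫⁻ u, φ ((states d X n).gen (pickFrom (states d X n).alive u)) ∂uniform01 ∂expPi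
        = V d (fpick φ) 0 n (initState (d 1)) := by
      unfold V
      refine lintegral_congr fun X => ?_
      rw [hoff]; rfl
    have hp1 := hpos 1 le_rfl
    have hdpos : d 1 ≠ 0 := by omega
    rw [e2, V_gen hs hpos φ n 0 _ hc1 hu1, bernoulliSumLaw,
      lintegral_map hφ (measurable_of_countable _)]
    have e3 : ∫⁻ x, φ (Finset.univ.filter (fun i => x i = true)).card
        ∂(Measure.pi fun i : Fin (n + 1) =>
          bernoulliDist ((fun i => (d i : ℝ) / ((s i : ℤ) : ℝ)) (i.1 + 1))) =
        Blaw (fun i => (d i : ℝ) / ((s i : ℤ) : ℝ)) 1 (n + 1) φ 0 := by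
      unfold Blaw; simp only [zero_add]
    rw [e3, Blaw_succ]
    have e4 : (d 1 : ℝ) / ((s 1 : ℤ) : ℝ) = 1 := by
      rw [hd1, Int.cast_natCast, div_self (by exact_mod_cast hdpos)]
    simp only [e4, sub_self, ENNReal.ofReal_one, ENNReal.ofReal_zero, one_mul, zero_mul, add_zero,
      zero_add]
    have e5 : ∀ v ∈ (initState (d 1)).alive,
        Blaw (fun i => (d i : ℝ) / ((s i : ℤ) : ℝ)) 2 n φ ((initState (d 1)).gen v) =
        Blaw (fun i => (d i : ℝ) / ((s i : ℤ) : ℝ)) 2 n φ 1 := by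
      intro v hv
      have : v ≠ 0 := by have := (Finset.mem_Icc.1 hv).1; omega
      simp [initState, this]
    rw [Finset.sum_congr rfl e5, Finset.sum_const, nsmul_eq_mul, ← mul_assoc,
      ENNReal.inv_mul_cancel (by simpa [initState] using hdpos) (by simp), one_mul]
  · refine Measure.ext_of_lintegral _ fun φ hφ => ?_
    have hmt : Measurable fun X : ℕ → ℝ => (states d X m).time := meas_time.comp (hmst m)
    rw [lintegral_map hφ (by exact hmt.comp hmS)]
    have e1 : ∫⁻ ω, φ (states d (fun v => F (some v) ω) m).time ∂μ =
        ∫⁻ X, φ (states d X m).time ∂expPi := by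
      rw [← hlaw, lintegral_map (by exact hφ.comp hmt) hmS]
    have e2 : ∫⁻ X, φ (states d X m).time ∂expPi =
        V d (fun st => φ st.time) 0 m (initState (d 1)) := by
      unfold V
      refine lintegral_congr fun X => ?_
      rw [hoff]
    rw [e1, e2, V_time hs hpos hφ m 0 _ hc1 hu1, expWeightedSumLaw, lintegral_map hφ (by fun_prop)]
    simp [Tlaw, initState]


end
end

section
/- Let I_1, …, I_m be independent Bernoulli random variables with P(I_i = 1) = ρ_i ∈ [0,1], let G_m = Σ_{i=1}^m I_i, and suppose σ² := Σ_{i=1}^m ρ_i(1−ρ_i) > 0. Define the standardized variable G̃_m = (G_m − Σ_{i=1}^m ρ_i)/σ. Then for every bounded 1-Lipschitz function g: ℝ → ℝ, |E[g(G̃_m)] − E[g(Z)]| ≤ 3/σ, where Z is a standard normal random variable; i.e., the Wasserstein distance (as a supremum over bounded 1-Lipschitz test functions) between the law of G̃_m and the standard normal law is at most 3/√(Σ_{i=1}^m ρ_i(1−ρ_i)). -/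
open MeasureTheory ProbabilityTheory Filter Real
open scoped ENNReal NNReal

noncomputable section

def sw (t : ℝ) : ℝ := Real.exp (-(1/2) * t ^ 2)

lemma sw_pos (t : ℝ) : 0 < sw t := Real.exp_pos _

lemma sw_int0 : Integrable sw := integrable_exp_neg_mul_sq (by norm_num)

lemma sw_int1 : Integrable (fun t => t * sw t) := integrable_mul_exp_neg_mul_sq (by norm_num)

lemma sw_int2 : Integrable (fun t => t ^ 2 * sw t) := by
  have := integrable_rpow_mul_exp_neg_mul_sq (b := 1/2) (by norm_num) (s := 2) (by norm_num)
  simpa [sw] using this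

lemma sw_hasDerivAt (t : ℝ) : HasDerivAt sw (-t * sw t) t := by
  have h : HasDerivAt (fun t : ℝ => -(1/2) * t ^ 2) (-t) t := by
    exact ((hasDerivAt_pow 2 t).const_mul (-(1/2) : ℝ)).congr_deriv (by norm_num; ring)
  exact h.exp.congr_deriv (by unfold sw; ring)

lemma sw_cont : Continuous sw := by unfold sw; fun_prop

lemma exp_half_tendsto : Tendsto (fun x : ℝ => Real.exp (-(1/2) * x)) atTop (nhds 0) := by
  have := tendsto_rpow_mul_exp_neg_mul_atTop_nhds_zero 0 (1/2) (by norm_num)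
  simpa using this

lemma sw_tendsto0 : Tendsto sw atTop (nhds 0) := by
  have := (rpow_mul_exp_neg_mul_sq_isLittleO_exp_neg (b := 1/2) (by norm_num) 0).isBigO.trans_tendsto
    exp_half_tendsto
  refine this.congr fun t => ?_
  simp [sw]

lemma sw_tendsto1 : Tendsto (fun t => t * sw t) atTop (nhds 0) := by
  have := (rpow_mul_exp_neg_mul_sq_isLittleO_exp_neg (b := 1/2) (by norm_num) 1).isBigO.trans_tendsto
    exp_half_tendsto
  simpa [sw] using this

lemma sw_I1 (x : ℝ) : ∫ t in Set.Ioi x, t * sw t = sw x := by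
  have := integral_Ioi_of_hasDerivAt_of_tendsto (f := fun t => - sw t) (f' := fun t => t * sw t)
    (a := x) (m := 0) (by have := sw_cont; fun_prop)
    (fun t _ => (sw_hasDerivAt t).neg.congr_deriv (by ring)) sw_int1.integrableOn
    (by simpa using sw_tendsto0.neg)
  simpa using this

lemma sw_I2 (x : ℝ) : ∫ t in Set.Ioi x, t ^ 2 * sw t = x * sw x + ∫ t in Set.Ioi x, sw t := by
  have := integral_Ioi_of_hasDerivAt_of_tendsto (f := fun t => - (t * sw t))
    (f' := fun t => t ^ 2 * sw t - sw t)
    (a := x) (m := 0) (by have := sw_cont; fun_prop)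
    (fun t _ => ((hasDerivAt_id t).mul (sw_hasDerivAt t)).neg.congr_deriv
      (by simp only [id]; ring)) (sw_int2.sub sw_int0).integrableOn
    (by simpa using sw_tendsto1.neg)
  rw [integral_sub sw_int2.integrableOn sw_int0.integrableOn] at this
  linarith

lemma half_line (h : ℝ → ℝ) (hL : ∀ a b, |h a - h b| ≤ |a - b|) (hb : ∀ x, |h x| ≤ 1 + |x|)
    (hi : Integrable (fun t => h t * sw t)) (x : ℝ) (hx : 0 ≤ x) :
    |(1 + x ^ 2) * ((∫ t in Set.Ioi x, h t * sw t) / sw x) - x * h x| ≤ 5 := by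
  set A := ∫ t in Set.Ioi x, h t * sw t with hA
  set N := ∫ t in Set.Ioi x, sw t with hN
  have hE := sw_pos x
  set E := sw x with hEdef
  have i0 : IntegrableOn sw (Set.Ioi x) := sw_int0.integrableOn
  have i1 : IntegrableOn (fun t => t * sw t) (Set.Ioi x) := sw_int1.integrableOn
  have i2 : IntegrableOn (fun t => t ^ 2 * sw t) (Set.Ioi x) := sw_int2.integrableOn
  have ih : IntegrableOn (fun t => h t * sw t) (Set.Ioi x) := hi.integrableOn
  have hN0 : 0 ≤ N := integral_nonneg fun t => (sw_pos t).le
  have e1 : ∫ t in Set.Ioi x, (t * sw t - x * sw t) = E - x * N := by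
    rw [integral_sub i1 (i0.const_mul x), sw_I1, integral_const_mul]
  have hxN : x * N ≤ E := by
    have : 0 ≤ ∫ t in Set.Ioi x, (t * sw t - x * sw t) := by
      apply setIntegral_nonneg measurableSet_Ioi
      intro t ht
      have := sw_pos t
      have ht : x < t := ht
      nlinarith
    linarith
  have hlow : x * E ≤ (1 + x ^ 2) * N := by
    have e2 : ∫ t in Set.Ioi x, (t ^ 2 * sw t - (2 * x) * (t * sw t) + x ^ 2 * sw t)
        = (x * E + N) - 2 * x * E + x ^ 2 * N := by
      have i3 : IntegrableOn (fun t => t ^ 2 * sw t - (2 * x) * (t * sw t)) (Set.Ioi x) :=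
        i2.sub (i1.const_mul _)
      rw [integral_add i3 (i0.const_mul _),
        integral_sub i2 (i1.const_mul _), sw_I2, integral_const_mul, integral_const_mul, sw_I1]
    have : 0 ≤ ∫ t in Set.Ioi x, (t ^ 2 * sw t - (2 * x) * (t * sw t) + x ^ 2 * sw t) := by
      apply integral_nonneg
      intro t
      have := mul_nonneg (sq_nonneg (t - x)) (sw_pos t).le
      simp only [Pi.zero_apply]
      nlinarith
    linarith
  have hAN : |A - h x * N| ≤ E - x * N := by
    have : A - h x * N = ∫ t in Set.Ioi x, (h t * sw t - h x * sw t) := by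
      rw [integral_sub ih (i0.const_mul _), integral_const_mul]
    rw [this, ← e1, ← Real.norm_eq_abs]
    apply norm_integral_le_of_norm_le (i1.sub (i0.const_mul x))
    refine (ae_restrict_iff' measurableSet_Ioi).2 (Eventually.of_forall fun t ht => ?_)
    have ht : x < t := ht
    have h1 := hL t x
    rw [abs_of_pos (by linarith : 0 < t - x)] at h1
    rw [← sub_mul, Real.norm_eq_abs, abs_mul, abs_of_pos (sw_pos t)]
    have := mul_le_mul_of_nonneg_right h1 (sw_pos t).le
    simp only [Pi.sub_apply]
    linarith
  have hM : (1 + x) * N ≤ 4 * E := by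
    rcases le_total 1 x with h1 | h1
    · nlinarith
    · have hNle : N ≤ 1.3 := by
        have a1 : N ≤ ∫ t in Set.Ioi (0:ℝ), sw t :=
          setIntegral_mono_set sw_int0.integrableOn
            (Eventually.of_forall fun t => (sw_pos t).le)
            (Set.Ioi_subset_Ioi hx).eventuallyLE
        have a2 : ∫ t in Set.Ioi (0:ℝ), sw t = √(π / (1/2)) / 2 := integral_gaussian_Ioi (1/2)
        have a3 : √(π / (1/2)) ≤ 2.6 := by
          apply Real.sqrt_le_iff.2
          constructor
          · norm_num
          · have := Real.pi_lt_d2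
            norm_num at this ⊢
            linarith
        linarith
      have hElow : (1/2 : ℝ) ≤ E := by
        have : -(1/2) * x ^ 2 + 1 ≤ E := Real.add_one_le_exp _
        nlinarith
      nlinarith
  have hA' : |A / E - h x * (N / E)| ≤ 1 - x * (N / E) := by
    have : A / E - h x * (N / E) = (A - h x * N) / E := by ring
    rw [this, abs_div, abs_of_pos hE, div_le_iff₀ hE]
    have : (1 - x * (N / E)) * E = E - x * N := by field_simp
    rw [this]; exact hAN
  have hlow' : x ≤ (1 + x ^ 2) * (N / E) := by
    rw [← mul_div_assoc, le_div_iff₀ hE]; exact hlow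
  have hM' : (1 + x) * (N / E) ≤ 4 := by
    rw [← mul_div_assoc, div_le_iff₀ hE]; exact hM
  have hxM : x * (N / E) ≤ 1 := by
    rw [← mul_div_assoc, div_le_iff₀ hE]; linarith
  set M := N / E with hMdef
  have hhx := hb x
  rw [abs_of_nonneg hx] at hhx
  have e : (1 + x ^ 2) * (A / E) - x * h x =
    (1 + x ^ 2) * (A / E - h x * M) + h x * ((1 + x ^ 2) * M - x) := by ring
  rw [e]
  refine (abs_add_le _ _).trans ?_
  rw [abs_mul, abs_mul, abs_of_nonneg (by positivity : 0 ≤ 1 + x ^ 2),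
    abs_of_nonneg (by linarith : 0 ≤ (1 + x ^ 2) * M - x)]
  have b1 : (1 + x ^ 2) * |A / E - h x * M| ≤ (1 + x ^ 2) * (1 - x * M) := by gcongr
  have b2 : |h x| * ((1 + x ^ 2) * M - x) ≤ (1 + x) * ((1 + x ^ 2) * M - x) := by
    apply mul_le_mul_of_nonneg_right hhx; linarith
  have b3 : (1 + x) * ((1 + x ^ 2) * M - x) ≤ (1 + x) * M := by
    apply mul_le_mul_of_nonneg_left _ (by linarith)
    nlinarith
  have b4 : (1 + x ^ 2) * (1 - x * M) ≤ 1 := by nlinarith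
  linarith

lemma full_line (h : ℝ → ℝ) (hL : ∀ a b, |h a - h b| ≤ |a - b|) (hb : ∀ x, |h x| ≤ 1 + |x|)
    (hi : Integrable (fun t => h t * sw t)) (h0 : ∫ t, h t * sw t = 0) (x : ℝ) :
    |(1 + x ^ 2) * ((∫ t in Set.Ioi x, h t * sw t) / sw x) - x * h x| ≤ 5 := by
  rcases le_total 0 x with hx | hx
  · exact half_line h hL hb hi x hx
  · have hsw : ∀ t, sw (-t) = sw t := fun t => by simp [sw]
    have := half_line (fun t => h (-t)) (fun a b => by
        refine (hL _ _).trans (le_of_eq ?_)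
        rw [← abs_neg]; congr 1; ring) (fun t => by simpa using hb (-t))
      (by have := hi.comp_neg; simpa [hsw] using this) (-x) (by linarith)
    have e : ∫ t in Set.Ioi (-x), h (-t) * sw t = - ∫ t in Set.Ioi x, h t * sw t := by
      have e1 := integral_comp_neg_Ioi (-x) (fun t => h t * sw t)
      simp only [hsw, neg_neg] at e1
      rw [e1]
      have := intervalIntegral.integral_Iic_add_Ioi (b := x) hi.integrableOn hi.integrableOn
      linarith
    rw [e, hsw, neg_neg] at this
    rw [← abs_neg]
    convert this using 2
    ring

/-- Stein solution. -/
lemma stein_solution (h : ℝ → ℝ) (hL : ∀ a b, |h a - h b| ≤ |a - b|) (hb : ∀ x, |h x| ≤ 1 + |x|)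
    (hi : Integrable (fun t => h t * sw t)) (h0 : ∫ t, h t * sw t = 0) :
    ∃ f f' : ℝ → ℝ, (∀ x, HasDerivAt f (f' x) x) ∧ (∀ x, f' x - x * f x = h x) ∧
      Continuous f' ∧ ∀ a b, |f' a - f' b| ≤ 6 * |a - b| := by
  have hc : Continuous h := by
    have : LipschitzWith 1 h := LipschitzWith.of_dist_le_mul fun a b => by
      simpa [Real.dist_eq] using hL a b
    exact this.continuous
  have hwc : Continuous (fun t => h t * sw t) := hc.mul sw_cont
  let f : ℝ → ℝ := fun x => - ((∫ t in Set.Ioi x, h t * sw t) / sw x)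
  let f' : ℝ → ℝ := fun x => x * f x + h x
  have hI : ∀ x, HasDerivAt (fun x => ∫ t in Set.Ioi x, h t * sw t) (-(h x * sw x)) x := by
    intro x
    have e : (fun x => ∫ t in Set.Ioi x, h t * sw t) =
        fun x => (∫ t in Set.Ioi 0, h t * sw t) - ∫ t in (0:ℝ)..x, h t * sw t := by
      funext y
      have := intervalIntegral.integral_interval_add_Ioi (a := 0) (b := y)
        hi.integrableOn hi.integrableOn
      linarith
    rw [e]
    exact (intervalIntegral.integral_hasDerivAt_right (hwc.intervalIntegrable _ _)
      (hwc.stronglyMeasurableAtFilter _ _) hwc.continuousAt).const_sub _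
  have hf : ∀ x, HasDerivAt f (f' x) x := by
    intro x
    refine ((hI x).div (sw_hasDerivAt x) (sw_pos x).ne').neg.congr_deriv ?_
    simp only [f', f]
    have := (sw_pos x).ne'
    field_simp
    ring
  have hfc : Continuous f := continuous_iff_continuousAt.2 fun x => (hf x).continuousAt
  refine ⟨f, f', hf, fun x => by simp [f'], by fun_prop, fun a b => ?_⟩
  have hd : ∀ x, HasDerivAt (fun x => x * f x) (f x + x * f' x) x := by
    intro x
    exact ((hasDerivAt_id x).mul (hf x)).congr_deriv (by simp)
  have hbd : ∀ x, ‖f x + x * f' x‖ ≤ 5 := by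
    intro x
    have := full_line h hL hb hi h0 x
    rw [← abs_neg] at this
    rw [Real.norm_eq_abs]
    convert this using 2
    simp only [f', f]
    ring
  have := Convex.norm_image_sub_le_of_norm_hasDerivWithin_le (s := Set.univ) (x := b) (y := a)
    (fun x _ => (hd x).hasDerivWithinAt) (fun x _ => hbd x) convex_univ trivial trivial
  rw [Real.norm_eq_abs, Real.norm_eq_abs] at this
  have e : f' a - f' b = (a * f a - b * f b) + (h a - h b) := by simp only [f']; ring
  rw [e]
  refine (abs_add_le _ _).trans ?_
  linarith [hL a b]

lemma taylor_bound (f f' : ℝ → ℝ) (hf : ∀ x, HasDerivAt f (f' x) x)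
    (hL : ∀ a b, |f' a - f' b| ≤ 6 * |a - b|) (a δ : ℝ) (hδ : 0 ≤ δ) :
    |f (a + δ) - f a - δ * f' a| ≤ 3 * δ ^ 2 ∧
    |f (a + δ) - f a - δ * f' (a + δ)| ≤ 3 * δ ^ 2 := by
  have hB : ∀ x : ℝ, HasDerivAt (fun x : ℝ => 3 * x ^ 2) (6 * x) x := by
    intro x
    exact ((hasDerivAt_pow 2 x).const_mul (3:ℝ)).congr_deriv (by norm_num; ring)
  constructor
  · have hd : ∀ x : ℝ, HasDerivAt (fun x => f (a + x) - f a - x * f' a) (f' (a + x) - f' a) x := by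
      intro x
      have h1 : HasDerivAt (fun x => f (a + x)) (f' (a + x)) x := (hf (a + x)).comp_const_add a x
      exact ((h1.sub_const (f a)).sub ((hasDerivAt_id x).mul_const (f' a))).congr_deriv (by simp)
    have := image_norm_le_of_norm_deriv_right_le_deriv_boundary (a := 0) (b := δ)
      (fun x _ => (hd x).continuousAt.continuousWithinAt) (fun x _ => (hd x).hasDerivWithinAt)
      (by simp) hB (fun x hx => by
        have := hL (a + x) a
        rw [add_sub_cancel_left, abs_of_nonneg hx.1] at this
        exact this) (x := δ) ⟨hδ, le_rfl⟩
    exact this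
  · set b := a + δ with hb
    have hd : ∀ x : ℝ, HasDerivAt (fun x => f b - f (b - x) - x * f' b) (f' (b - x) - f' b) x := by
      intro x
      have h1 : HasDerivAt (fun x => f (b - x)) (-f' (b - x)) x := (hf (b - x)).comp_const_sub b x
      exact ((h1.const_sub (f b)).sub ((hasDerivAt_id x).mul_const (f' b))).congr_deriv (by simp)
    have := image_norm_le_of_norm_deriv_right_le_deriv_boundary (a := 0) (b := δ)
      (fun x _ => (hd x).continuousAt.continuousWithinAt) (fun x _ => (hd x).hasDerivWithinAt)
      (by simp) hB (fun x hx => by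
        have := hL (b - x) b
        rw [show b - x - b = -x by ring, abs_neg, abs_of_nonneg hx.1] at this
        exact this) (x := δ) ⟨hδ, le_rfl⟩
    have e : b - δ = a := by rw [hb]; ring
    rw [e] at this
    exact this

lemma gauss_part (g : ℝ → ℝ) (hg : LipschitzWith 1 g) (C : ℝ) (hC : ∀ x, |g x| ≤ C) :
    (∀ x, |g x - ∫ z, g z ∂(gaussianReal 0 1)| ≤ 1 + |x|) ∧
    Integrable (fun t => (g t - ∫ z, g z ∂(gaussianReal 0 1)) * sw t) ∧
    ∫ t, (g t - ∫ z, g z ∂(gaussianReal 0 1)) * sw t = 0 := by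
  set c := ∫ z, g z ∂(gaussianReal 0 1) with hc
  have hgi : Integrable g (gaussianReal 0 1) :=
    Integrable.of_bound hg.continuous.aestronglyMeasurable C (Eventually.of_forall hC)
  have hmem : MemLp id 2 (gaussianReal 0 1) := by
    exact_mod_cast memLp_id_gaussianReal (μ := 0) (v := 1) 2
  have hsq : Integrable (fun z : ℝ => z ^ 2) (gaussianReal 0 1) := hmem.integrable_sq
  have hid : Integrable (fun z : ℝ => z) (gaussianReal 0 1) :=
    hmem.integrable (by norm_num)
  have hsq1 : ∫ z, z ^ 2 ∂(gaussianReal 0 1) = 1 := by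
    have h1 := variance_id_gaussianReal (μ := 0) (v := 1)
    rw [variance_of_integral_eq_zero aemeasurable_id (by simp)] at h1
    simpa using h1
  have habs : ∫ z, |z| ∂(gaussianReal 0 1) ≤ 1 := by
    have : ∫ z, |z| ∂(gaussianReal 0 1) ≤ ∫ z, (1 + z ^ 2) / 2 ∂(gaussianReal 0 1) := by
      apply integral_mono hid.abs (((integrable_const _).add hsq).div_const 2)
      intro z
      simp only [Pi.add_apply]
      nlinarith [sq_nonneg (|z| - 1), sq_abs z]
    rw [integral_div, integral_add (integrable_const _) hsq, hsq1] at this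
    simp at this
    linarith
  refine ⟨fun x => ?_, ?_, ?_⟩
  · have e : g x - c = ∫ z, (g x - g z) ∂(gaussianReal 0 1) := by
      rw [integral_sub (integrable_const _) hgi]; simp [hc]
    rw [e, ← Real.norm_eq_abs]
    have : ‖∫ z, (g x - g z) ∂(gaussianReal 0 1)‖ ≤ ∫ z, (|x| + |z|) ∂(gaussianReal 0 1) := by
      apply norm_integral_le_of_norm_le ((integrable_const _).add hid.abs)
      refine Eventually.of_forall fun z => ?_
      have := hg.dist_le_mul x z
      simp only [Real.dist_eq, NNReal.coe_one, one_mul] at this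
      exact this.trans (abs_sub _ _)
    rw [integral_add (integrable_const _) hid.abs] at this
    simp at this
    simp
    linarith
  · apply sw_int0.bdd_mul (c := C + |c|)
    · exact (hg.continuous.sub continuous_const).aestronglyMeasurable
    · exact Eventually.of_forall fun t => (abs_sub _ _).trans (by linarith [hC t])
  · have h1 : ∫ z, (g z - c) ∂(gaussianReal 0 1) = 0 := by
      rw [integral_sub hgi (integrable_const _)]; simp [hc]
    rw [integral_gaussianReal_eq_integral_smul (by norm_num)] at h1
    have e : ∀ z, gaussianPDFReal 0 1 z • (g z - c) = (√(2 * π))⁻¹ * ((g z - c) * sw z) := by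
      intro z
      simp only [gaussianPDFReal_def, sw, smul_eq_mul, NNReal.coe_one, mul_one, sub_zero]
      rw [show -z ^ 2 / 2 = -(1/2) * z ^ 2 by ring]
      ring
    simp only [e] at h1
    rw [integral_const_mul] at h1
    rcases mul_eq_zero.1 h1 with h2 | h2
    · have : 0 < (√(2 * π))⁻¹ := by positivity
      linarith
    · exact h2

lemma indep_split {Ω : Type} [MeasurableSpace Ω] (μ : Measure Ω) [IsProbabilityMeasure μ]
    (B S : Ω → ℝ) (hB : Measurable B) (hS : Measurable S) (hind : IndepFun B S μ) (ρ : ℝ)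
    (hBi : Integrable B μ)
    (hρ : ∫ ω, B ω ∂μ = ρ) (u v : ℝ → ℝ) (hu : Continuous u) (hv : Continuous v)
    (iu : Integrable (fun ω => u (S ω)) μ) (iv : Integrable (fun ω => v (S ω)) μ)
    (iBu : Integrable (fun ω => B ω * u (S ω)) μ)
    (iBv : Integrable (fun ω => (1 - B ω) * v (S ω)) μ) :
    ∫ ω, (B ω * u (S ω) + (1 - B ω) * v (S ω)) ∂μ
      = ∫ ω, (ρ * u (S ω) + (1 - ρ) * v (S ω)) ∂μ := by
  rw [integral_add iBu iBv, integral_add (iu.const_mul _) (iv.const_mul _),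
    integral_const_mul, integral_const_mul]
  have h1 : IndepFun B (fun ω => u (S ω)) μ := hind.comp measurable_id hu.measurable
  have h2 : IndepFun (fun ω => 1 - B ω) (fun ω => v (S ω)) μ :=
    hind.comp (φ := fun x => 1 - x) (by fun_prop) hv.measurable
  rw [h1.integral_fun_mul_eq_mul_integral hB.aestronglyMeasurable
      (hu.measurable.comp hS).aestronglyMeasurable,
    h2.integral_fun_mul_eq_mul_integral (by fun_prop)
      (hv.measurable.comp hS).aestronglyMeasurable, integral_sub (integrable_const _) hBi, hρ]
  simp

/-- **Wasserstein bound for sums of independent Bernoulli random variables** (Lemma 3.4 of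
Bhamidi–van der Hofstad–Hooghiemstra): if `I₁, …, I_m` are independent Bernoulli(ρᵢ) and
`σ² = Σ ρᵢ(1-ρᵢ) > 0`, then for every bounded 1-Lipschitz `g`,
`|E[g(G̃_m)] - E[g(Z)]| ≤ 3/σ` where `G̃_m = (Σ Iᵢ - Σ ρᵢ)/σ` and `Z ~ N(0,1)`;
i.e. the Wasserstein distance (sup over bounded 1-Lipschitz test functions) between the law
of `G̃_m` and the standard normal law is at most `3/√(Σ ρᵢ(1-ρᵢ))`. -/
theorem wasserstein_bernoulli_sum
    (Ω : Type) [MeasurableSpace Ω] (μ : Measure Ω) [IsProbabilityMeasure μ]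
    (m : ℕ) (ρ : Fin m → ℝ) (hρ : ∀ i, ρ i ∈ Set.Icc (0 : ℝ) 1)
    (I : Fin m → Ω → Bool)
    (hmeas : ∀ i, Measurable (I i))
    (hindep : iIndepFun I μ)
    (hlaw : ∀ i, μ.map (I i) = bernoulliDist (ρ i))
    (σ : ℝ) (hσ : σ = Real.sqrt (∑ i, ρ i * (1 - ρ i)))
    (hσpos : 0 < ∑ i, ρ i * (1 - ρ i))
    (Gtil : Ω → ℝ)
    (hGtil : ∀ ω, Gtil ω =
      ((∑ i, (if I i ω then (1 : ℝ) else 0)) - ∑ i, ρ i) / σ) :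
    ∀ g : ℝ → ℝ, LipschitzWith 1 g → (∃ C, ∀ x, |g x| ≤ C) →
      |(∫ ω, g (Gtil ω) ∂μ) - ∫ x, g x ∂(gaussianReal 0 1)| ≤ 3 / σ := by
  intro g hg ⟨C, hC⟩
  obtain ⟨hb, hi, h0⟩ := gauss_part g hg C hC
  obtain ⟨f, f', hf, hst, hf'c, hfL⟩ := stein_solution
    (fun t => g t - ∫ z, g z ∂(gaussianReal 0 1))
    (fun a b => by
      have := hg.dist_le_mul a b
      simpa [Real.dist_eq] using this) hb hi h0
  have hfc : Continuous f := continuous_iff_continuousAt.2 fun x => (hf x).continuousAt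
  have hσ0 : 0 < σ := by rw [hσ]; exact Real.sqrt_pos.2 hσpos
  have hσ2 : σ ^ 2 = ∑ i, ρ i * (1 - ρ i) := by rw [hσ]; exact Real.sq_sqrt hσpos.le
  -- integrability of anything factoring through the Booleans
  have hfac : ∀ F : (Fin m → Bool) → ℝ, Integrable (fun ω => F (fun i => I i ω)) μ := by
    intro F
    have hm : Measurable (fun ω => fun i => I i ω) := measurable_pi_lambda _ hmeas
    haveI := Measure.isProbabilityMeasure_map (μ := μ) hm.aemeasurable
    have : Integrable F (μ.map (fun ω => fun i => I i ω)) := Integrable.of_finite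
    exact this.comp_measurable hm
  let β : Bool → ℝ := fun b => if b then 1 else 0
  let B : Fin m → Ω → ℝ := fun i ω => β (I i ω)
  let S : Fin m → Ω → ℝ := fun i ω => ∑ j ∈ Finset.univ.erase i, B j ω
  have hβ : Measurable β := measurable_from_top
  have hBm : ∀ i, Measurable (B i) := fun i => hβ.comp (hmeas i)
  have hSm : ∀ i, Measurable (S i) := fun i => Finset.measurable_sum _ fun j _ => hBm j
  have hBind : iIndepFun B μ := hindep.comp (fun _ => β) (fun _ => hβ)
  have hBS : ∀ i, IndepFun (B i) (S i) μ := by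
    intro i
    have := (hBind.indepFun_finsetSum_of_notMem hBm (Finset.notMem_erase i Finset.univ)).symm
    convert this using 1
    funext ω
    simp [S]
  have hBint : ∀ i, ∫ ω, B i ω ∂μ = ρ i := by
    intro i
    have e : ∫ ω, B i ω ∂μ = ∫ b, β b ∂(μ.map (I i)) :=
      (integral_map (hmeas i).aemeasurable hβ.aestronglyMeasurable).symm
    have k := hρ i
    rw [e, hlaw i, bernoulliDist, integral_add_measure, integral_smul_measure,
      integral_smul_measure, integral_dirac, integral_dirac]
    · simp [β, k.1]
    · exact (integrable_dirac (by simp)).smul_measure (by simp)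
    · exact (integrable_dirac (by simp)).smul_measure (by simp)
  set R := ∑ i, ρ i with hR
  have hW : ∀ i ω, Gtil ω = (B i ω + S i ω - R) / σ := by
    intro i ω
    rw [hGtil ω]
    congr 2
    exact (Finset.add_sum_erase Finset.univ (fun j => B j ω) (Finset.mem_univ i)).symm
  have hWB : ∀ ω, Gtil ω = ∑ i, (B i ω - ρ i) / σ := by
    intro ω
    rw [hGtil ω, ← Finset.sum_div, Finset.sum_sub_distrib]
  have hfacW : ∀ (i : Fin m) (F : ℝ → ℝ → ℝ → ℝ),
      Integrable (fun ω => F (B i ω) (S i ω) (Gtil ω)) μ := by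
    intro i F
    have := hfac (fun b => F (β (b i)) (∑ j ∈ Finset.univ.erase i, β (b j))
      (((∑ j, (if b j then (1:ℝ) else 0)) - R) / σ))
    refine this.congr (Eventually.of_forall fun ω => ?_)
    simp only [hGtil ω, B, S]
  let T : Fin m → Ω → ℝ := fun i ω =>
    (ρ i * (1 - ρ i) / σ ^ 2) * f' (Gtil ω) - (B i ω - ρ i) / σ * f (Gtil ω)
  have hTi : ∀ i, Integrable (T i) μ := fun i =>
    hfacW i (fun b _ w => (ρ i * (1 - ρ i) / σ ^ 2) * f' w - (b - ρ i) / σ * f w)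
  have hgi : Integrable (fun ω => g (Gtil ω)) μ := by
    have hGm : Measurable Gtil := by
      have : Gtil = fun ω => ∑ i, (B i ω - ρ i) / σ := funext hWB
      rw [this]
      exact Finset.measurable_sum _ fun i _ => ((hBm i).sub_const _).div_const _
    exact Integrable.of_bound (hg.continuous.measurable.comp hGm).aestronglyMeasurable C
      (Eventually.of_forall fun ω => hC _)
  have hmain : (∫ ω, g (Gtil ω) ∂μ) - ∫ x, g x ∂(gaussianReal 0 1) = ∑ i, ∫ ω, T i ω ∂μ := by
    rw [← integral_finset_sum _ (fun i _ => hTi i)]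
    have : (∫ ω, g (Gtil ω) ∂μ) - ∫ x, g x ∂(gaussianReal 0 1)
        = ∫ ω, (g (Gtil ω) - ∫ x, g x ∂(gaussianReal 0 1)) ∂μ := by
      rw [integral_sub hgi (integrable_const _)]; simp
    rw [this]
    refine integral_congr_ae (Eventually.of_forall fun ω => ?_)
    simp only [T]
    rw [Finset.sum_sub_distrib, ← Finset.sum_mul, ← Finset.sum_mul, ← hWB, ← Finset.sum_div,
      ← hσ2, div_self (by positivity), one_mul]
    exact (hst _).symm
  have hterm : ∀ i, |∫ ω, T i ω ∂μ| ≤ (ρ i * (1 - ρ i) / σ ^ 2) * (3 / σ) := by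
    intro i
    set v := ρ i * (1 - ρ i) with hv
    have hv0 : 0 ≤ v := mul_nonneg (hρ i).1 (by linarith [(hρ i).2])
    let a : ℝ → ℝ := fun s => (s - R) / σ
    let U : ℝ → ℝ := fun s => v / σ ^ 2 * f' (a s + 1 / σ) - (1 - ρ i) / σ * f (a s + 1 / σ)
    let V : ℝ → ℝ := fun s => v / σ ^ 2 * f' (a s) + ρ i / σ * f (a s)
    have hac : Continuous a := by fun_prop
    have e1 : ∫ ω, T i ω ∂μ = ∫ ω, (B i ω * U (S i ω) + (1 - B i ω) * V (S i ω)) ∂μ := by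
      refine integral_congr_ae (Eventually.of_forall fun ω => ?_)
      have hB01 : B i ω = 1 ∨ B i ω = 0 := by
        simp only [B, β]; split_ifs <;> simp
      simp only [T, U, V, a]
      rw [hW i ω]
      rcases hB01 with h | h
      · rw [h, show (1 + S i ω - R) / σ = (S i ω - R) / σ + 1 / σ by ring]
        ring
      · rw [h, zero_add]
        ring
    rw [e1, indep_split μ (B i) (S i) (hBm i) (hSm i) (hBS i) (ρ i)
      (hfacW i (fun b _ _ => b)) (hBint i) U V (by fun_prop) (by fun_prop)
      (hfacW i (fun _ s _ => U s)) (hfacW i (fun _ s _ => V s))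
      (hfacW i (fun b s _ => b * U s)) (hfacW i (fun b s _ => (1 - b) * V s))]
    have hpt : ∀ s, |ρ i * U s + (1 - ρ i) * V s| ≤ v / σ ^ 2 * (3 / σ) := by
      intro s
      obtain ⟨t1, t2⟩ := taylor_bound f f' hf hfL (a s) (1 / σ) (by positivity)
      set δ := 1 / σ with hδ
      set x := a s
      have e : ρ i * U s + (1 - ρ i) * V s =
          - (v / σ) * (ρ i * (f (x + δ) - f x - δ * f' (x + δ)) +
            (1 - ρ i) * (f (x + δ) - f x - δ * f' x)) := by
        simp only [U, V]
        rw [show v / σ ^ 2 = v / σ * δ by rw [hδ]; ring, hv]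
        ring
      rw [e, abs_mul, abs_neg, abs_of_nonneg (by positivity : 0 ≤ v / σ)]
      have r0 := (hρ i).1
      have r1 : 0 ≤ 1 - ρ i := by linarith [(hρ i).2]
      have b : |ρ i * (f (x + δ) - f x - δ * f' (x + δ)) +
            (1 - ρ i) * (f (x + δ) - f x - δ * f' x)| ≤ 3 * δ ^ 2 := by
        refine (abs_add_le _ _).trans ?_
        rw [abs_mul, abs_mul, abs_of_nonneg r0, abs_of_nonneg r1]
        nlinarith [mul_le_mul_of_nonneg_left t2 r0, mul_le_mul_of_nonneg_left t1 r1]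
      calc v / σ * _ ≤ v / σ * (3 * δ ^ 2) := mul_le_mul_of_nonneg_left b (by positivity)
        _ = v / σ ^ 2 * (3 / σ) := by rw [hδ]; field_simp
    have := norm_integral_le_of_norm_le_const (μ := μ)
      (f := fun ω => ρ i * U (S i ω) + (1 - ρ i) * V (S i ω))
      (Eventually.of_forall fun ω => hpt (S i ω))
    simpa using this
  rw [hmain]
  calc |∑ i, ∫ ω, T i ω ∂μ| ≤ ∑ i, |∫ ω, T i ω ∂μ| := Finset.abs_sum_le_sum_abs _ _
    _ ≤ ∑ i, (ρ i * (1 - ρ i) / σ ^ 2) * (3 / σ) := Finset.sum_le_sum fun i _ => hterm i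
    _ = 3 / σ := by
      rw [← Finset.sum_mul, ← Finset.sum_div, ← hσ2, div_self (by positivity), one_mul]

end
end

section
/- Let λ > 1, let D_1, D_2, … be i.i.d. Poisson(λ) random variables, and set S_i = (Σ_{j=1}^i D_j) − (i−1). Conditionally on D_1,…,D_m, let I_1,…,I_m be independent Bernoulli random variables with P(I_i = 1 | D_1,…,D_m) = D_i/S_i (on the event S_i > 0 for all i ≤ m), and set G_m = Σ_{i=1}^m I_i. Let β = λ/(λ−1). Then the conditional law of (G_m − β·log m)/√(β·log m), given the event {S_i > 0 for all 1 ≤ i ≤ m}, converges weakly as m→∞ to the standard normal distribution. -/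
open MeasureTheory ProbabilityTheory Filter Real
open scoped ENNReal NNReal

noncomputable section

/-- The Poisson distribution with parameter `l` on `ℕ`. -/
def poissonDist (l : ℝ) : Measure ℕ :=
  Measure.count.withDensity (fun n => ENNReal.ofReal (Real.exp (-l) * l ^ n / n.factorial))

lemma aux_prod_diff (s : Finset ℕ) (a b : ℕ → ℂ) (ha : ∀ i ∈ s, ‖a i‖ ≤ 1)
    (hb : ∀ i ∈ s, ‖b i‖ ≤ 1) :
    ‖∏ i ∈ s, a i - ∏ i ∈ s, b i‖ ≤ ∑ i ∈ s, ‖a i - b i‖ := by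
  induction s using Finset.induction_on with
  | empty => simp
  | insert j s hj ih =>
    rw [Finset.prod_insert hj, Finset.prod_insert hj, Finset.sum_insert hj]
    have h1 := ih (fun i hi => ha i (Finset.mem_insert_of_mem hi))
      (fun i hi => hb i (Finset.mem_insert_of_mem hi))
    have h2 : ‖∏ i ∈ s, b i‖ ≤ 1 := by
      rw [norm_prod]
      exact Finset.prod_le_one (fun _ _ => norm_nonneg _)
        (fun i hi => hb i (Finset.mem_insert_of_mem hi))
    have h3 := ha j (Finset.mem_insert_self _ _)
    calc ‖a j * ∏ i ∈ s, a i - b j * ∏ i ∈ s, b i‖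
        = ‖a j * (∏ i ∈ s, a i - ∏ i ∈ s, b i) + (a j - b j) * ∏ i ∈ s, b i‖ := by ring_nf
      _ ≤ ‖a j‖ * ‖∏ i ∈ s, a i - ∏ i ∈ s, b i‖ + ‖a j - b j‖ * ‖∏ i ∈ s, b i‖ := by
          refine (norm_add_le _ _).trans ?_
          rw [norm_mul, norm_mul]
      _ ≤ _ := by
          have := norm_nonneg (a j - b j)
          have := norm_nonneg (∏ i ∈ s, a i - ∏ i ∈ s, b i)
          nlinarith

lemma aux_norm_le (p θ : ℝ) (h0 : 0 ≤ p) (h1 : p ≤ 1) :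
    ‖1 + (p : ℂ) * (Complex.exp (θ * Complex.I) - 1)‖ ≤ 1 := by
  have : 1 + (p : ℂ) * (Complex.exp (θ * Complex.I) - 1)
      = ((1 - p : ℝ) : ℂ) + (p : ℂ) * Complex.exp (θ * Complex.I) := by push_cast; ring
  rw [this]
  refine (norm_add_le _ _).trans ?_
  rw [norm_mul, Complex.norm_exp_ofReal_mul_I, Complex.norm_real, Complex.norm_real,
    Real.norm_of_nonneg h0, Real.norm_of_nonneg (by linarith)]
  linarith

lemma aux_exp_norm_le (p θ : ℝ) (h0 : 0 ≤ p) :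
    ‖Complex.exp ((p : ℂ) * (Complex.exp (θ * Complex.I) - 1))‖ ≤ 1 := by
  rw [Complex.norm_exp]
  have : ((p : ℂ) * (Complex.exp (θ * Complex.I) - 1)).re = p * (Real.cos θ - 1) := by
    rw [Complex.re_ofReal_mul]; simp [Complex.exp_ofReal_mul_I_re]
  rw [this]
  have := Real.cos_le_one θ
  exact Real.exp_le_one_iff.2 (by nlinarith)

lemma aux_z (θ : ℝ) : ‖Complex.exp (θ * Complex.I) - 1‖ ≤ |θ| := by
  have := Real.norm_exp_I_mul_ofReal_sub_one_le (x := θ)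
  rw [mul_comm]; simpa using this

lemma aux_taylor (θ : ℝ) (h : |θ| ≤ 1) :
    ‖Complex.exp (θ * Complex.I) - 1 - θ * Complex.I + θ ^ 2 / 2‖ ≤ 3 * |θ| ^ 3 := by
  have := Complex.norm_exp_sub_sum_le_norm_mul_exp (θ * Complex.I) 3
  simp only [Finset.sum_range_succ, Finset.sum_range_zero, norm_mul, Complex.norm_real,
    Complex.norm_I, mul_one, Real.norm_eq_abs] at this
  have h2 : Real.exp |θ| ≤ 3 := by
    have := Real.exp_one_lt_d9
    have := Real.exp_le_exp.2 h
    linarith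
  have h3 : Complex.exp (θ * Complex.I) - 1 - θ * Complex.I + θ ^ 2 / 2 =
    Complex.exp (θ * Complex.I) - (0 + (θ * Complex.I) ^ 0 / (Nat.factorial 0 : ℂ)
      + (θ * Complex.I) ^ 1 / (Nat.factorial 1 : ℂ) + (θ * Complex.I) ^ 2 / (Nat.factorial 2 : ℂ)) := by
    simp [mul_pow]; ring
  rw [h3]
  refine this.trans ?_
  have : 0 ≤ |θ| ^ 3 := by positivity
  nlinarith

lemma clt_det (p : ℕ → ℝ) (L : ℕ → ℝ) (C t : ℝ) (hL : Tendsto L atTop atTop)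
    (hp0 : ∀ i, 1 ≤ i → 0 ≤ p i) (hp1 : ∀ i, 1 ≤ i → p i ≤ 1)
    (hsum : ∀ m, 1 ≤ m → |∑ i ∈ Finset.Icc 1 m, p i - L m| ≤ C)
    (hsq : ∀ m, ∑ i ∈ Finset.Icc 1 m, p i ^ 2 ≤ C) :
    Tendsto (fun m => Complex.exp (((-(t / √(L m) * L m) : ℝ) : ℂ) * Complex.I) *
      ∏ i ∈ Finset.Icc 1 m, (1 + (p i : ℂ) * (Complex.exp (((t / √(L m) : ℝ) : ℂ) * Complex.I) - 1)))
      atTop (nhds (Complex.exp (-(t : ℂ) ^ 2 / 2))) := by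
  set θ : ℕ → ℝ := fun m => t / √(L m) with hθ
  set z : ℕ → ℂ := fun m => Complex.exp ((θ m : ℂ) * Complex.I) - 1 with hz
  have hθ0 : Tendsto θ atTop (nhds 0) := by
    refine Tendsto.const_div_atTop ?_ t
    exact Real.tendsto_sqrt_atTop.comp hL
  have hθa : Tendsto (fun m => |θ m|) atTop (nhds 0) := by simpa using hθ0.abs
  have hz0 : ∀ m, ‖z m‖ ≤ |θ m| := fun m => aux_z _
  have hL0 : ∀ᶠ m in atTop, 0 < L m := hL.eventually_gt_atTop 0
  have hLθ : ∀ᶠ m in atTop, L m * θ m ^ 2 = t ^ 2 := by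
    filter_upwards [hL0] with m hm
    simp only [hθ, div_pow, Real.sq_sqrt hm.le]
    field_simp
  -- step 1
  have h1 : Tendsto (fun m => Complex.exp (((-(θ m * L m) : ℝ) : ℂ) * Complex.I) *
      ∏ i ∈ Finset.Icc 1 m, (1 + (p i : ℂ) * z m) - 
      Complex.exp (((-(θ m * L m) : ℝ) : ℂ) * Complex.I) *
      ∏ i ∈ Finset.Icc 1 m, Complex.exp ((p i : ℂ) * z m)) atTop (nhds 0) := by
    refine squeeze_zero_norm' (a := fun m => |θ m| ^ 2 * C) ?_ (by simpa using (hθa.pow 2).mul_const C)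
    filter_upwards [hθa.eventually_le_const (u := 1) one_pos] with m hm
    rw [← mul_sub, norm_mul, Complex.norm_exp_ofReal_mul_I, one_mul]
    refine (aux_prod_diff _ _ _ (fun i hi => aux_norm_le _ _ (hp0 i (Finset.mem_Icc.1 hi).1) (hp1 i (Finset.mem_Icc.1 hi).1))
      (fun i hi => aux_exp_norm_le _ _ (hp0 i (Finset.mem_Icc.1 hi).1))).trans ?_
    calc ∑ i ∈ Finset.Icc 1 m, ‖1 + (p i : ℂ) * z m - Complex.exp ((p i : ℂ) * z m)‖
        ≤ ∑ i ∈ Finset.Icc 1 m, |θ m| ^ 2 * p i ^ 2 := by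
          refine Finset.sum_le_sum fun i hi => ?_
          have h0 := hp0 i (Finset.mem_Icc.1 hi).1
          have h1 := hp1 i (Finset.mem_Icc.1 hi).1
          have hn : ‖(p i : ℂ) * z m‖ ≤ p i * |θ m| := by
            rw [norm_mul, Complex.norm_real, Real.norm_of_nonneg h0]
            exact mul_le_mul_of_nonneg_left (hz0 m) h0
          have := Complex.norm_exp_sub_one_sub_id_le (x := (p i : ℂ) * z m)
            (hn.trans (by nlinarith [abs_nonneg (θ m)]))
          rw [← norm_neg]
          have e : -(1 + (p i : ℂ) * z m - Complex.exp ((p i : ℂ) * z m)) =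
            Complex.exp ((p i : ℂ) * z m) - 1 - (p i : ℂ) * z m := by ring
          rw [e]
          refine this.trans ?_
          calc _ ≤ (p i * |θ m|) ^ 2 := by gcongr
            _ = _ := by ring
      _ ≤ _ := by
          rw [← Finset.mul_sum]
          exact mul_le_mul_of_nonneg_left (hsq m) (by positivity)
  have h2 : Tendsto (fun m => Complex.exp (((-(θ m * L m) : ℝ) : ℂ) * Complex.I) *
      ∏ i ∈ Finset.Icc 1 m, Complex.exp ((p i : ℂ) * z m)) atTop
      (nhds (Complex.exp (-(t : ℂ) ^ 2 / 2))) := by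
    simp_rw [← Complex.exp_sum, ← Complex.exp_add]
    refine (Complex.continuous_exp.tendsto _).comp ?_
    rw [tendsto_iff_norm_sub_tendsto_zero]
    refine squeeze_zero_norm' (a := fun m => t ^ 2 * (3 * |θ m|) + C * |θ m|) ?_ ?_
    swap
    · simpa using ((hθa.const_mul 3).const_mul (t ^ 2)).add (hθa.const_mul C)
    filter_upwards [hθa.eventually_le_const (u := 1) one_pos, hLθ, hL0, eventually_ge_atTop 1] with m hm hLm hLp hm1
    rw [norm_norm]
    have e : ((-(θ m * L m) : ℝ) : ℂ) * Complex.I + ∑ i ∈ Finset.Icc 1 m, (p i : ℂ) * z m - -(t : ℂ) ^ 2 / 2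
      = (L m : ℂ) * (Complex.exp (θ m * Complex.I) - 1 - θ m * Complex.I + θ m ^ 2 / 2)
        + ((∑ i ∈ Finset.Icc 1 m, p i - L m : ℝ) : ℂ) * z m := by
      have : (t : ℂ) ^ 2 = L m * θ m ^ 2 := by exact_mod_cast hLm.symm
      rw [this, ← Finset.sum_mul]
      simp only [hz]
      push_cast
      ring
    rw [e]
    refine (norm_add_le _ _).trans ?_
    rw [norm_mul, norm_mul, Complex.norm_real, Complex.norm_real, Real.norm_of_nonneg hLp.le]
    have hC := hsum m hm1
    refine add_le_add ?_ ?_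
    · calc _ ≤ L m * (3 * |θ m| ^ 3) := mul_le_mul_of_nonneg_left (aux_taylor _ hm) hLp.le
        _ = (L m * |θ m| ^ 2) * (3 * |θ m|) := by ring
        _ = _ := by rw [sq_abs, hLm]
    · exact mul_le_mul hC (hz0 m) (norm_nonneg _) ((abs_nonneg _).trans hC)
  have h3 := h1.add h2
  simp only [sub_add_cancel, zero_add] at h3
  exact h3

lemma aux_abel (M : ℕ → ℝ) (h0 : M 0 = 0) (m : ℕ) :
    ∑ i ∈ Finset.Icc 1 m, (M i - M (i - 1)) / i =
      M m / (m + 1) + ∑ i ∈ Finset.Icc 1 m, M i / (i * (i + 1)) := by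
  induction m with
  | zero => simp [h0]
  | succ n ih =>
    rw [Finset.sum_Icc_succ_top (by omega), Finset.sum_Icc_succ_top (by omega), ih]
    have h1 : (n : ℝ) + 1 ≠ 0 := by positivity
    have h2 : (n : ℝ) + 1 + 1 ≠ 0 := by positivity
    simp only [Nat.add_sub_cancel]
    push_cast
    field_simp
    ring

lemma aux_harm (m : ℕ) (hm : 1 ≤ m) : |∑ i ∈ Finset.Icc 1 m, (1 : ℝ) / i - Real.log m| ≤ 1 := by
  have h1 := log_add_one_le_harmonic m
  have h2 := harmonic_le_one_add_log m
  have h3 : ((harmonic m : ℚ) : ℝ) = ∑ i ∈ Finset.Icc 1 m, (1 : ℝ) / i := by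
    rw [harmonic_eq_sum_Icc]; push_cast; simp
  rw [h3] at h1 h2
  have : Real.log m ≤ Real.log (m + 1 : ℕ) := by
    apply Real.log_le_log
    · exact_mod_cast hm
    · push_cast; linarith
  rw [abs_le]; constructor <;> linarith

lemma aux_amgm (i : ℕ) (hi : 1 ≤ i) (x y : ℝ) :
    |x| * |y| / (i : ℝ) ^ 2 ≤ x ^ 2 / (i * √i) + y ^ 2 / (i ^ 2 * √i) := by
  have hi' : (0 : ℝ) < i := by exact_mod_cast hi
  have hs : 0 < √(i : ℝ) := Real.sqrt_pos.2 hi'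
  have hss : √(i : ℝ) ^ 2 = i := Real.sq_sqrt hi'.le
  set s := √(i : ℝ)
  rw [← hss]
  have e : x ^ 2 / (s ^ 2 * s) + y ^ 2 / ((s ^ 2) ^ 2 * s) = (s ^ 2 * x ^ 2 + y ^ 2) / s ^ 5 := by
    field_simp
  have e2 : |x| * |y| / (s ^ 2) ^ 2 = (s * |x| * |y|) / s ^ 5 := by field_simp
  rw [e, e2]
  gcongr
  rw [← sq_abs x, ← sq_abs y]
  nlinarith [sq_nonneg (s * |x| - |y|), mul_nonneg (mul_nonneg hs.le (abs_nonneg x)) (abs_nonneg y)]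

lemma aux_sum_le (f g : ℕ → ℝ) (hg : Summable g) (hg0 : ∀ i, 0 ≤ g i)
    (h : ∀ i, 1 ≤ i → |f i| ≤ g i) (m : ℕ) :
    |∑ i ∈ Finset.Icc 1 m, f i| ≤ ∑' i, g i :=
  (Finset.abs_sum_le_sum_abs _ _).trans
    ((Finset.sum_le_sum fun i hi => h i (Finset.mem_Icc.1 hi).1).trans
      (hg.sum_le_tsum _ fun i _ => hg0 i))

lemma det_sums (lam : ℝ) (hlam : 1 < lam) (D S M : ℕ → ℝ)
    (hM0 : M 0 = 0) (hMD : ∀ i, 1 ≤ i → M i - M (i - 1) = D i - lam)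
    (hS : ∀ i, S i = (lam - 1) * i + 1 + M i)
    (hS1 : ∀ i, 1 ≤ i → 1 ≤ S i)
    (hlim : Tendsto (fun i : ℕ => M i / i) atTop (nhds 0))
    (ha : Summable fun i : ℕ => M i ^ 2 / ((i : ℝ) ^ 2 * √i))
    (hb : Summable fun i : ℕ => D i ^ 2 / ((i : ℝ) * √i)) :
    ∃ C, (∀ m, 1 ≤ m → |∑ i ∈ Finset.Icc 1 m, D i / S i - lam / (lam - 1) * Real.log m| ≤ C) ∧
      (∀ m, ∑ i ∈ Finset.Icc 1 m, (D i / S i) ^ 2 ≤ C) := by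
  have hl : 0 < lam - 1 := by linarith
  -- lower bound
  obtain ⟨c, hc, hcS⟩ : ∃ c > 0, ∀ i, 1 ≤ i → c * i ≤ S i := by
    have := hlim.eventually_const_le (u := -((lam - 1) / 2)) (by linarith)
    obtain ⟨N, hN⟩ := eventually_atTop.1 this
    refine ⟨min ((lam - 1) / 2) (1 / (N + 1)), by positivity, fun i hi => ?_⟩
    have hi' : (0 : ℝ) < i := by exact_mod_cast hi
    rcases le_total N i with h | h
    · have h1 := hN i h
      rw [le_div_iff₀ hi'] at h1
      have : min ((lam - 1) / 2) (1 / ((N : ℝ) + 1)) * i ≤ (lam - 1) / 2 * i := by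
        gcongr; exact min_le_left _ _
      rw [hS]; linarith
    · refine le_trans ?_ (hS1 i hi)
      calc _ ≤ 1 / ((N : ℝ) + 1) * i := by gcongr; exact min_le_right _ _
        _ ≤ 1 := by
          rw [div_mul_eq_mul_div, div_le_one (by positivity)]
          have : (i : ℝ) ≤ N := by exact_mod_cast h
          linarith
  obtain ⟨B, hB⟩ : ∃ B, ∀ m : ℕ, |M m / (m + 1)| ≤ B := by
    obtain ⟨B, hB⟩ := (Metric.isBounded_range_of_tendsto _ hlim).exists_norm_le
    refine ⟨B, fun m => ?_⟩
    have h1 : |M m / m| ≤ B := hB _ ⟨m, rfl⟩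
    rcases Nat.eq_zero_or_pos m with h | h
    · subst h; simpa [hM0] using h1
    · refine le_trans ?_ h1
      have : (0 : ℝ) < m := by exact_mod_cast h
      rw [abs_div, abs_div, abs_of_pos this, abs_of_pos (by positivity : (0 : ℝ) < m + 1)]
      gcongr; linarith
  set a : ℕ → ℝ := fun i : ℕ => M i ^ 2 / ((i : ℝ) ^ 2 * √i) with ha'
  set b : ℕ → ℝ := fun i : ℕ => D i ^ 2 / ((i : ℝ) * √i) with hb'
  set d : ℕ → ℝ := fun i : ℕ => 1 ^ 2 / ((i : ℝ) * √i) with hd'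
  set d2 : ℕ → ℝ := fun i : ℕ => 1 ^ 2 / ((i : ℝ) ^ 2 * √i) with hd2'
  have ha0 : ∀ i, 0 ≤ a i := fun i => by positivity
  have hb0 : ∀ i, 0 ≤ b i := fun i => by positivity
  have hd0 : ∀ i, 0 ≤ d i := fun i => by positivity
  have hd20 : ∀ i, 0 ≤ d2 i := fun i => by positivity
  have hd : Summable d := by
    have := Real.summable_one_div_nat_rpow.2 (show (1 : ℝ) < 3 / 2 by norm_num)
    refine this.congr fun i => ?_
    rcases Nat.eq_zero_or_pos i with h | h
    · subst h; simp [hd']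
    · have h' : (0 : ℝ) < i := by exact_mod_cast h
      simp only [hd']
      rw [Real.sqrt_eq_rpow, show (3 / 2 : ℝ) = 1 + 1 / 2 by norm_num, Real.rpow_add h', Real.rpow_one]
      norm_num
  have hd2 : Summable d2 := by
    refine Summable.of_nonneg_of_le hd20 (fun i => ?_) hd
    rcases Nat.eq_zero_or_pos i with h | h
    · subst h; simp [hd', hd2']
    · have h' : (1 : ℝ) ≤ i := by exact_mod_cast h
      simp only [hd', hd2']
      have : 0 < √(i : ℝ) := Real.sqrt_pos.2 (by linarith)
      gcongr
      nlinarith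
  -- error terms
  set r : ℕ → ℝ := fun i => D i * (1 + M i) / ((lam - 1) * i * S i) with hr
  set K : ℝ := 1 / ((lam - 1) * c) with hK
  have hK0 : 0 < K := by positivity
  have hrb : ∀ i, 1 ≤ i → |r i| ≤ K * (b i + d2 i + (b i + a i)) := by
    intro i hi
    have hi' : (0 : ℝ) < i := by exact_mod_cast hi
    have hSi := hcS i hi
    have hSp : 0 < S i := by linarith [hS1 i hi]
    have h1 := aux_amgm i hi (D i) 1
    have h2 := aux_amgm i hi (D i) (M i)
    simp only [hr]
    rw [abs_div, abs_mul, abs_of_pos (by positivity : 0 < (lam - 1) * i * S i)]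
    calc |D i| * |1 + M i| / ((lam - 1) * i * S i)
        ≤ |D i| * (|1| + |M i|) / ((lam - 1) * i * (c * i)) := by
          gcongr
          exact abs_add_le _ _
      _ = K * (|D i| * |1| / (i : ℝ) ^ 2 + |D i| * |M i| / (i : ℝ) ^ 2) := by
          rw [hK]; field_simp
      _ ≤ _ := by
          gcongr
  have hMb : ∀ i : ℕ, 1 ≤ i → |M i / (i * (i + 1))| ≤ d i + a i := by
    intro i hi
    have hi' : (0 : ℝ) < i := by exact_mod_cast hi
    have h2 := aux_amgm i hi 1 (M i)
    refine le_trans ?_ h2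
    rw [abs_div, abs_of_pos (by positivity : 0 < (i : ℝ) * (i + 1)), abs_one, one_mul]
    gcongr
    nlinarith
  have hp : ∀ i, 1 ≤ i → D i / S i = lam / (lam - 1) * (1 / i) +
      1 / (lam - 1) * ((M i - M (i - 1)) / i) - r i := by
    intro i hi
    have hi' : (0 : ℝ) < i := by exact_mod_cast hi
    have hSp : 0 < S i := by linarith [hS1 i hi]
    have e := hMD i hi
    have e2 := hS i
    rw [e]
    simp only [hr]
    field_simp
    rw [e2]; ring
  have hsq : ∀ i, 1 ≤ i → |(D i / S i) ^ 2| ≤ 1 / c ^ 2 * b i := by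
    intro i hi
    have hi' : (0 : ℝ) < i := by exact_mod_cast hi
    have hi1 : (1 : ℝ) ≤ i := by exact_mod_cast hi
    have hSi := hcS i hi
    have hsi : √(i : ℝ) ≤ i := by
      rw [Real.sqrt_le_left hi'.le]; nlinarith
    have : 0 < √(i : ℝ) := Real.sqrt_pos.2 hi'
    rw [abs_of_nonneg (by positivity), div_pow]
    calc D i ^ 2 / S i ^ 2 ≤ D i ^ 2 / (c * i) ^ 2 := by gcongr
      _ = 1 / c ^ 2 * (D i ^ 2 / (i * i)) := by field_simp
      _ ≤ _ := by simp only [hb']; gcongr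
  set C1 := lam / (lam - 1) * 1 + 1 / (lam - 1) * (B + ∑' i, (d i + a i)) +
    ∑' i, K * (b i + d2 i + (b i + a i))
  set C2 := ∑' i, 1 / c ^ 2 * b i
  refine ⟨max C1 C2, fun m hm => le_trans ?_ (le_max_left _ _), fun m => le_trans ?_ (le_max_right _ _)⟩
  · have e : ∑ i ∈ Finset.Icc 1 m, D i / S i - lam / (lam - 1) * Real.log m =
        lam / (lam - 1) * (∑ i ∈ Finset.Icc 1 m, (1 : ℝ) / i - Real.log m) +
        1 / (lam - 1) * (M m / (m + 1) + ∑ i ∈ Finset.Icc 1 m, M i / (i * (i + 1)))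
        - ∑ i ∈ Finset.Icc 1 m, r i := by
      rw [← aux_abel M hM0, Finset.sum_congr rfl fun i hi => hp i (Finset.mem_Icc.1 hi).1,
        Finset.sum_sub_distrib, Finset.sum_add_distrib, ← Finset.mul_sum, ← Finset.mul_sum]
      ring
    rw [e]
    refine (abs_sub _ _).trans (add_le_add ((abs_add_le _ _).trans (add_le_add ?_ ?_)) ?_)
    · rw [abs_mul, abs_of_pos (by positivity)]
      gcongr
      exact aux_harm m hm
    · rw [abs_mul, abs_of_pos (by positivity)]
      gcongr
      refine (abs_add_le _ _).trans (add_le_add (hB m) ?_)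
      exact aux_sum_le _ _ (hd.add ha) (fun i => add_nonneg (hd0 i) (ha0 i)) hMb m
    · refine aux_sum_le _ _ (((hb.add hd2).add (hb.add ha)).mul_left K) (fun i => ?_) hrb m
      have := ha0 i
      have := hb0 i
      have := hd20 i
      positivity
  · refine (le_abs_self _).trans (aux_sum_le _ _ (hb.mul_left _) (fun i => ?_) hsq m)
    have := hb0 i
    positivity
lemma poissonDist_eq (r : ℝ≥0) : poissonDist r = poissonMeasure r := by
  apply Measure.ext_of_singleton
  intro n
  rw [poissonMeasure_singleton, poissonDist, withDensity_apply _ (measurableSet_singleton n)]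
  simp

lemma pois_sq (r : ℝ≥0) : Integrable (fun n : ℕ => (n : ℝ) ^ 2) (poissonMeasure r) := by
  rw [integrable_poissonMeasure_iff]
  have h := (Real.summable_pow_div_factorial (4 * (r : ℝ))).mul_left (Real.exp (-r))
  refine Summable.of_nonneg_of_le (fun n => by positivity) (fun n => ?_) h
  have h1 : (n : ℝ) ≤ 2 ^ n := by exact_mod_cast (Nat.lt_two_pow_self (n := n)).le
  have h2 : (n : ℝ) ^ 2 ≤ 4 ^ n := by
    calc (n : ℝ) ^ 2 ≤ (2 ^ n) ^ 2 := by gcongr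
      _ = 4 ^ n := by rw [← pow_mul, mul_comm, pow_mul]; norm_num
  rw [Real.norm_of_nonneg (by positivity), mul_pow]
  calc Real.exp (-r) * r ^ n / n.factorial * (n : ℝ) ^ 2
      ≤ Real.exp (-r) * r ^ n / n.factorial * 4 ^ n := by gcongr
    _ = _ := by ring

lemma pois_mean (r : ℝ≥0) : ∫ n : ℕ, (n : ℝ) ∂(poissonMeasure r) = r := by
  rw [integral_poissonMeasure]
  have h := (hasSum_one_poissonMeasure r).mul_left (r : ℝ)
  have e : ∀ n : ℕ, (Real.exp (-r) * r ^ (n + 1) / (n + 1).factorial) • ((n + 1 : ℕ) : ℝ) =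
      r * (Real.exp (-r) * r ^ n / n.factorial) := by
    intro n
    rw [Nat.factorial_succ]; push_cast
    have : (n : ℝ) + 1 ≠ 0 := by positivity
    have : (n.factorial : ℝ) ≠ 0 := by positivity
    simp only [smul_eq_mul]
    field_simp
    ring
  have h2 : HasSum (fun n : ℕ => (Real.exp (-r) * r ^ (n + 1) / (n + 1).factorial) • ((n + 1 : ℕ) : ℝ)) (r * 1) := by
    simp_rw [e]; exact h
  have h3 := (hasSum_nat_add_iff (f := fun n : ℕ => (Real.exp (-r) * r ^ n / n.factorial) • (n : ℝ)) 1).1 h2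
  rw [h3.tsum_eq]; simp

instance : IsProbabilityMeasure uniform01 := ⟨by simp [uniform01]⟩

lemma unif_int (p : ℝ) (z : ℂ) (h0 : 0 ≤ p) (h1 : p ≤ 1) :
    ∫ u, (if u < p then z else 1) ∂uniform01 = 1 + p * (z - 1) := by
  have e : (fun u : ℝ => if u < p then z else 1) =
      fun u => 1 + (Set.Iio p).indicator (fun _ => z - 1) u := by
    funext u
    by_cases h : u < p <;> simp [h]
  rw [e, integral_add (integrable_const _) ((integrable_const _).indicator measurableSet_Iio),
    integral_indicator measurableSet_Iio]
  simp only [integral_const, measureReal_def, Measure.restrict_apply MeasurableSet.univ]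
  have : uniform01 (Set.univ ∩ Set.Iio p) = ENNReal.ofReal p := by
    rw [uniform01, Measure.restrict_apply (by measurability)]
    have : Set.univ ∩ Set.Iio p ∩ Set.Ico 0 1 = Set.Ico 0 p := by
      ext x; simp; constructor
      · rintro ⟨a, b, c⟩; exact ⟨b, a⟩
      · rintro ⟨a, b⟩; exact ⟨b, a, by linarith⟩
    rw [this]; simp
  rw [this, ENNReal.toReal_ofReal h0]
  simp

lemma ae_summable_of_integral {Ω : Type*} [MeasurableSpace Ω] (μ : Measure Ω)
    (f : ℕ → Ω → ℝ) (hf0 : ∀ i ω, 0 ≤ f i ω) (hfi : ∀ i, Integrable (f i) μ)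
    (hs : Summable fun i => ∫ ω, f i ω ∂μ) : ∀ᵐ ω ∂μ, Summable fun i => f i ω := by
  have h1 : ∫⁻ ω, ∑' i, ENNReal.ofReal (f i ω) ∂μ ≠ ∞ := by
    rw [lintegral_tsum (fun i => (hfi i).aemeasurable.ennreal_ofReal)]
    simp_rw [← fun i => ofReal_integral_eq_lintegral_ofReal (hfi i) (ae_of_all _ (hf0 i))]
    exact hs.tsum_ofReal_ne_top
  have h2 := ae_lt_top' (AEMeasurable.tsum fun i => (hfi i).aemeasurable.ennreal_ofReal) h1
  filter_upwards [h2] with ω hω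
  have := ENNReal.summable_toReal hω.ne
  refine this.congr fun i => ?_
  rw [ENNReal.toReal_ofReal (hf0 i ω)]

lemma summable_aux : Summable fun i : ℕ => 1 / ((i : ℝ) * √i) := by
  have := Real.summable_one_div_nat_rpow.2 (show (1 : ℝ) < 3 / 2 by norm_num)
  refine this.congr fun i => ?_
  rcases Nat.eq_zero_or_pos i with h | h
  · subst h; simp
  · have h' : (0 : ℝ) < i := by exact_mod_cast h
    rw [Real.sqrt_eq_rpow, show (3 / 2 : ℝ) = 1 + 1 / 2 by norm_num, Real.rpow_add h', Real.rpow_one]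

lemma as_facts {Ω : Type*} [MeasurableSpace Ω] (μ : Measure Ω) [IsProbabilityMeasure μ]
    (D : ℕ → Ω → ℝ) (lam : ℝ) (hindep : iIndepFun D μ)
    (hident : ∀ i, IdentDistrib (D i) (D 1) μ μ) (hL2 : MemLp (D 1) 2 μ) (hmean : μ[D 1] = lam) :
    ∀ᵐ ω ∂μ, Tendsto (fun i : ℕ => (∑ j ∈ Finset.Icc 1 i, D j ω - lam * i) / i) atTop (nhds 0) ∧
      (Summable fun i : ℕ => (∑ j ∈ Finset.Icc 1 i, D j ω - lam * i) ^ 2 / ((i : ℝ) ^ 2 * √i)) ∧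
      (Summable fun i : ℕ => D i ω ^ 2 / ((i : ℝ) * √i)) := by
  have hmem : ∀ i, MemLp (D i) 2 μ := fun i => (hident i).memLp_iff.2 hL2
  have hmeani : ∀ i, μ[D i] = lam := fun i => (hident i).integral_eq.trans hmean
  have A1 : ∀ᵐ ω ∂μ, Tendsto (fun i : ℕ => (∑ j ∈ Finset.Icc 1 i, D j ω - lam * i) / i) atTop (nhds 0) := by
    have := strong_law_ae_real (μ := μ) (fun i => D (i + 1)) ((hmem 1).integrable (by norm_num))
      (fun i j hij => hindep.indepFun (by omega : i + 1 ≠ j + 1)) (fun i => hident (i + 1))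
    filter_upwards [this] with ω hω
    have e : (fun i : ℕ => (∑ j ∈ Finset.Icc 1 i, D j ω - lam * i) / i) =ᶠ[atTop]
        fun n : ℕ => (∑ i ∈ Finset.range n, D (i + 1) ω) / n - lam := by
      filter_upwards [eventually_gt_atTop 0] with n hn
      have hn' : (n : ℝ) ≠ 0 := by positivity
      rw [Finset.range_eq_Ico, Finset.sum_Ico_add' (fun i => D i ω) 0 n 1]
      rw [show Finset.Ico (0 + 1) (n + 1) = Finset.Icc 1 n by ext x; simp]
      field_simp
    rw [tendsto_congr' e]
    have h2 := hω.sub_const lam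
    simp only [zero_add] at h2
    rw [hmean, sub_self] at h2
    exact h2
  have A2 : ∀ᵐ ω ∂μ, Summable fun i : ℕ => (∑ j ∈ Finset.Icc 1 i, D j ω - lam * i) ^ 2 / ((i : ℝ) ^ 2 * √i) := by
    have hmS : ∀ i : ℕ, MemLp (fun ω => ∑ j ∈ Finset.Icc 1 i, D j ω) 2 μ := fun i =>
      memLp_finsetSum _ fun j _ => hmem j
    have hv : ∀ i : ℕ, ∫ ω, (∑ j ∈ Finset.Icc 1 i, D j ω - lam * i) ^ 2 ∂μ = i * variance (D 1) μ := by
      intro i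
      have h1 : variance (∑ j ∈ Finset.Icc 1 i, D j) μ = i * variance (D 1) μ := by
        rw [IndepFun.variance_sum (fun j _ => hmem j)
          (fun j _ k _ hjk => hindep.indepFun hjk)]
        rw [Finset.sum_congr rfl fun j _ => (hident j).variance_eq]
        simp
      rw [← h1, variance_eq_integral]
      · have : ∫ ω, (∑ j ∈ Finset.Icc 1 i, D j) ω ∂μ = lam * i := by
          simp only [Finset.sum_apply]
          rw [integral_finsetSum _ fun j _ => (hmem j).integrable (by norm_num)]
          simp_rw [hmeani]; simp [mul_comm]
        rw [this]; simp
      · have := (hmS i).aestronglyMeasurable.aemeasurable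
        convert this using 1
        ext ω; simp
    refine ae_summable_of_integral μ _ (fun i ω => by positivity) (fun i => ?_) ?_
    · exact ((hmS i).sub (memLp_const _)).integrable_sq.div_const _
    · simp_rw [integral_div, hv]
      refine (summable_aux.mul_left (variance (D 1) μ)).congr fun i => ?_
      rcases Nat.eq_zero_or_pos i with h | h
      · subst h; simp
      · have h' : (0 : ℝ) < i := by exact_mod_cast h
        have : 0 < √(i : ℝ) := Real.sqrt_pos.2 h'
        field_simp
  have A3 : ∀ᵐ ω ∂μ, Summable fun i : ℕ => D i ω ^ 2 / ((i : ℝ) * √i) := by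
    refine ae_summable_of_integral μ _ (fun i ω => by positivity) (fun i => ?_) ?_
    · exact (hmem i).integrable_sq.div_const _
    · have hv : ∀ i, ∫ ω, D i ω ^ 2 ∂μ = ∫ ω, D 1 ω ^ 2 ∂μ := fun i => (hident i).sq.integral_eq
      simp_rw [integral_div, hv]
      refine (summable_aux.mul_left (∫ ω, D 1 ω ^ 2 ∂μ)).congr fun i => ?_
      ring
  filter_upwards [A1, A2, A3] with ω h1 h2 h3 using ⟨h1, h2, h3⟩
lemma pos_lemma {Ω : Type*} [MeasurableSpace Ω] (μ : Measure Ω) [IsProbabilityMeasure μ]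
    (D : ℕ → Ω → ℕ) (hmeas : ∀ i, Measurable (D i)) (hindep : iIndepFun D μ)
    (hpos : ∀ K : ℕ, 0 < μ {ω | K ≤ D 1 ω})
    (hb : ∀ᵐ ω ∂μ, ∃ K : ℕ, ∀ i : ℕ, 1 ≤ i →
      -(K : ℤ) < (∑ j ∈ Finset.Icc 2 i, (D j ω : ℤ)) - ((i : ℤ) - 1)) :
    0 < μ {ω | ∀ i : ℕ, 1 ≤ i → 0 < (∑ j ∈ Finset.Icc 1 i, (D j ω : ℤ)) - ((i : ℤ) - 1)} := by
  set B : ℕ → Set Ω := fun K => {ω | ∀ i : ℕ, 1 ≤ i →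
      -(K : ℤ) < (∑ j ∈ Finset.Icc 2 i, (D j ω : ℤ)) - ((i : ℤ) - 1)} with hB
  have hBU : μ (⋃ K, B K) ≠ 0 := by
    have : ∀ᵐ ω ∂μ, ω ∈ ⋃ K, B K := by
      filter_upwards [hb] with ω hω
      simpa [hB] using hω
    have h2 : (⋃ K, B K) =ᵐ[μ] Set.univ := eventuallyEq_univ.2 this
    rw [measure_congr h2]
    simp
  obtain ⟨K, hK⟩ : ∃ K, μ (B K) ≠ 0 := by
    by_contra! h
    exact hBU (measure_iUnion_null h)
  have hle : ∀ i, (MeasurableSpace.comap (D i) inferInstance) ≤ ‹MeasurableSpace Ω› :=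
    fun i => (hmeas i).comap_le
  have hind := indep_iSup_of_disjoint hle hindep
    (S := {1}) (T := {i | 2 ≤ i}) (by simp)
  rw [Indep_iff] at hind
  have h1 := hind {ω | K + 1 ≤ D 1 ω} (B K) ?_ ?_
  · refine lt_of_lt_of_le ?_ (measure_mono (s := {ω | K + 1 ≤ D 1 ω} ∩ B K) ?_)
    · rw [h1]
      exact ENNReal.mul_pos (hpos (K + 1)).ne' hK
    · rintro ω ⟨hω1, hω2⟩ i hi
      have h2 := hω2 i hi
      have h3 : K + 1 ≤ D 1 ω := hω1
      rw [← Finset.insert_Icc_succ_left_eq_Icc hi, Finset.sum_insert (by simp)]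
      simp only [Order.succ_eq_add_one, Nat.reduceAdd]
      zify at h3
      linarith
  · exact le_iSup₂ (f := fun i (_ : i ∈ ({1} : Set ℕ)) => MeasurableSpace.comap (D i) inferInstance)
      1 rfl _ ⟨Set.Ici (K + 1), MeasurableSet.of_discrete, rfl⟩
  · have hD : ∀ j, 2 ≤ j → Measurable[⨆ i ∈ {i | 2 ≤ i}, MeasurableSpace.comap (D i) inferInstance]
        (fun ω => (D j ω : ℤ)) := by
      intro j hj
      have h0 : Measurable[⨆ i ∈ {i | 2 ≤ i}, MeasurableSpace.comap (D i) inferInstance] (D j) :=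
        (comap_measurable (D j)).mono
          (le_iSup₂ (f := fun i (_ : i ∈ {i : ℕ | 2 ≤ i}) => MeasurableSpace.comap (D i) inferInstance)
            j hj) le_rfl
      exact (Measurable.of_discrete (f := fun n : ℕ => (n : ℤ))).comp h0
    have e : B K = ⋂ i : ℕ, ⋂ (_ : 1 ≤ i), (fun ω => ∑ j ∈ Finset.Icc 2 i, (D j ω : ℤ)) ⁻¹'
        {x | -(K : ℤ) < x - ((i : ℤ) - 1)} := by
      ext ω; simp [hB]
    rw [e]
    refine MeasurableSet.iInter fun i => MeasurableSet.iInter fun _ => ?_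
    exact (Finset.measurable_sum _ fun j hj => hD j (Finset.mem_Icc.1 hj).1) MeasurableSet.of_discrete

lemma disint {Ω ι : Type*} [Fintype ι] [MeasurableSpace Ω] (μ : Measure Ω) [IsProbabilityMeasure μ]
    (ν : Measure ℕ) [IsProbabilityMeasure ν]
    (V : ι → Ω → ℕ × ℝ) (hmeas : ∀ i, Measurable (V i)) (hindep : iIndepFun V μ)
    (hlaw : ∀ i, μ.map (V i) = ν.prod uniform01)
    (P : Set (ι → ℕ)) (q : (ι → ℕ) → ι → ℝ) (hq0 : ∀ d ∈ P, ∀ i, 0 ≤ q d i)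
    (hq1 : ∀ d ∈ P, ∀ i, q d i ≤ 1) (z : ℂ) (hz : ‖z‖ ≤ 1) :
    ∫ ω, P.indicator 1 (fun i => (V i ω).1) *
        ∏ i, (if (V i ω).2 < q (fun i => (V i ω).1) i then z else 1) ∂μ =
    ∫ ω, P.indicator 1 (fun i => (V i ω).1) *
        ∏ i, (1 + (q (fun i => (V i ω).1) i : ℂ) * (z - 1)) ∂μ := by
  have hW : μ.map (fun ω => ((fun i => (V i ω).1), (fun i => (V i ω).2))) =
      (Measure.pi fun _ : ι => ν).prod (Measure.pi fun _ : ι => uniform01) := by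
    have h1 := hindep.map_fun_eq_pi_map (fun i => (hmeas i).aemeasurable)
    simp_rw [hlaw] at h1
    rw [← (measurePreserving_arrowProdEquivProdArrow ℕ ℝ ι (fun _ => ν) (fun _ => uniform01)).map_eq,
      ← h1, Measure.map_map (MeasurableEquiv.measurable _) (measurable_pi_lambda _ hmeas)]
    rfl
  have hWm : Measurable (fun ω => ((fun i => (V i ω).1), (fun i => (V i ω).2))) :=
    (measurable_pi_lambda _ fun i => (hmeas i).fst).prodMk
      (measurable_pi_lambda _ fun i => (hmeas i).snd)
  set f : (ι → ℕ) × (ι → ℝ) → ℂ := fun x => P.indicator 1 x.1 *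
        ∏ i, (if x.2 i < q x.1 i then z else 1) with hf
  set g : (ι → ℕ) → ℂ := fun d => P.indicator 1 d * ∏ i, (1 + (q d i : ℂ) * (z - 1)) with hg
  have hfm : Measurable f := by
    refine measurable_from_prod_countable_right fun d => ?_
    have hm : Measurable fun u : ι → ℝ => ∏ i, (if u i < q d i then z else (1 : ℂ)) := by
      refine Finset.measurable_fun_prod _ fun i _ => ?_
      exact Measurable.ite (measurableSet_lt (measurable_pi_apply i) measurable_const)
        measurable_const measurable_const
    exact hm.const_mul (P.indicator 1 d)
  have hfb : ∀ x, ‖f x‖ ≤ 1 := by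
    intro x
    simp only [hf]
    rw [norm_mul, norm_prod]
    refine mul_le_one₀ ?_ (by positivity) (Finset.prod_le_one (fun _ _ => norm_nonneg _) fun i _ => ?_)
    · by_cases h : x.1 ∈ P <;> simp [h]
    · split_ifs <;> simp [hz]
  have hfi : Integrable f ((Measure.pi fun _ : ι => ν).prod (Measure.pi fun _ : ι => uniform01)) :=
    Integrable.of_bound hfm.aestronglyMeasurable 1 (ae_of_all _ hfb)
  have hin : ∀ d, ∫ u, f (d, u) ∂(Measure.pi fun _ : ι => uniform01) = g d := by
    intro d
    simp only [hf, hg]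
    by_cases h : d ∈ P
    · rw [integral_const_mul]
      rw [integral_fintype_prod_eq_prod (fun i u => if u < q d i then z else 1)]
      congr 1
      exact Finset.prod_congr rfl fun i _ => unif_int _ _ (hq0 d h i) (hq1 d h i)
    · simp [h]
  calc _ = ∫ ω, f ((fun i => (V i ω).1), (fun i => (V i ω).2)) ∂μ := rfl
    _ = ∫ x, f x ∂((Measure.pi fun _ : ι => ν).prod (Measure.pi fun _ : ι => uniform01)) := by
      rw [← hW, integral_map hWm.aemeasurable hfm.aestronglyMeasurable]
    _ = ∫ d, g d ∂(Measure.pi fun _ : ι => ν) := by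
      rw [integral_prod _ hfi]; simp_rw [hin]
    _ = ∫ x, g x.1 ∂((Measure.pi fun _ : ι => ν).prod (Measure.pi fun _ : ι => uniform01)) := by
      rw [integral_fun_fst]; simp
    _ = ∫ ω, g (fun i => (V i ω).1) ∂μ := by
      rw [← hW, integral_map hWm.aemeasurable]
      exact ((Measurable.of_discrete (f := g)).comp measurable_fst).aestronglyMeasurable

/-- the walk -/
def walk (e : ℕ → ℕ) (i : ℕ) : ℤ := (∑ j ∈ Finset.Icc 1 i, (e j : ℤ)) - ((i : ℤ) - 1)

lemma walk_ge (e : ℕ → ℕ) (m : ℕ) (h : ∀ i : ℕ, 1 ≤ i → i ≤ m → 0 < walk e i) (i : ℕ) (h1 : 1 ≤ i)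
    (h2 : i ≤ m) : (e i : ℤ) ≤ walk e i := by
  obtain ⟨n, rfl⟩ : ∃ n, i = n + 1 := ⟨i - 1, by omega⟩
  have e1 : walk e (n + 1) = walk e n + e (n + 1) - 1 := by
    simp only [walk]
    rw [Finset.sum_Icc_succ_top (by omega)]
    push_cast; ring
  have e2 : 0 < walk e n := by
    rcases Nat.eq_zero_or_pos n with hn | hn
    · subst hn; simp [walk]
    · exact h n hn (by omega)
  omega

lemma walk_frac (e : ℕ → ℕ) (m : ℕ) (h : ∀ i : ℕ, 1 ≤ i → i ≤ m → 0 < walk e i) (i : ℕ) (h1 : 1 ≤ i)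
    (h2 : i ≤ m) : 0 ≤ (e i : ℝ) / (walk e i : ℝ) ∧ (e i : ℝ) / (walk e i : ℝ) ≤ 1 := by
  have h3 := walk_ge e m h i h1 h2
  have h4 := h i h1 h2
  have h5 : (e i : ℝ) ≤ (walk e i : ℝ) := by exact_mod_cast h3
  have h6 : (0 : ℝ) < (walk e i : ℝ) := by exact_mod_cast h4
  exact ⟨by positivity, (div_le_one h6).2 h5⟩

lemma walk_congr (e e' : ℕ → ℕ) (i : ℕ) (h : ∀ j ∈ Finset.Icc 1 i, e j = e' j) :
    walk e i = walk e' i := by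
  simp only [walk]
  rw [Finset.sum_congr rfl fun j hj => by rw [h j hj]]

lemma key_id {Ω : Type*} [MeasurableSpace Ω] (μ : Measure Ω) [IsProbabilityMeasure μ]
    (ν : Measure ℕ) [IsProbabilityMeasure ν]
    (V : ℕ → Ω → ℕ × ℝ) (hmeas : ∀ i, Measurable (V i)) (hindep : iIndepFun V μ)
    (hlaw : ∀ i, μ.map (V i) = ν.prod uniform01) (m : ℕ) (z : ℂ) (hz : ‖z‖ ≤ 1) :
    ∫ ω, {ω | ∀ i : ℕ, 1 ≤ i → i ≤ m → 0 < walk (fun j => (V j ω).1) i}.indicator 1 ω *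
        ∏ i ∈ Finset.Icc 1 m,
          (if (V i ω).2 < ((V i ω).1 : ℝ) / (walk (fun j => (V j ω).1) i : ℝ) then z else 1) ∂μ =
    ∫ ω, {ω | ∀ i : ℕ, 1 ≤ i → i ≤ m → 0 < walk (fun j => (V j ω).1) i}.indicator 1 ω *
        ∏ i ∈ Finset.Icc 1 m,
          (1 + (((V i ω).1 / (walk (fun j => (V j ω).1) i : ℝ) : ℝ) : ℂ) * (z - 1)) ∂μ := by
  classical
  set ex : ((Finset.Icc 1 m) → ℕ) → ℕ → ℕ := fun d j =>
    if h : j ∈ Finset.Icc 1 m then d ⟨j, h⟩ else 0 with hex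
  set P : Set ((Finset.Icc 1 m) → ℕ) := {d | ∀ i : ℕ, 1 ≤ i → i ≤ m → 0 < walk (ex d) i} with hP
  set q : ((Finset.Icc 1 m) → ℕ) → (Finset.Icc 1 m) → ℝ := fun d i => (d i : ℝ) / (walk (ex d) i : ℝ) with hq
  have hexi : ∀ d (i : Finset.Icc 1 m), ex d i = d i := by
    intro d i; simp only [hex]; rw [dif_pos i.2]
  have hfr : ∀ d ∈ P, ∀ i, 0 ≤ q d i ∧ q d i ≤ 1 := by
    intro d hd i
    have := walk_frac (ex d) m hd i (Finset.mem_Icc.1 i.2).1 (Finset.mem_Icc.1 i.2).2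
    rw [hexi] at this
    exact this
  have hw : ∀ ω (i : ℕ), i ≤ m → walk (ex fun i => (V i ω).1) i = walk (fun j => (V j ω).1) i := by
    intro ω i hi
    apply walk_congr
    intro j hj
    have : j ∈ Finset.Icc 1 m := by
      rw [Finset.mem_Icc] at hj ⊢; omega
    simp only [hex]; rw [dif_pos this]
  have hind : ∀ ω, ({ω | ∀ i : ℕ, 1 ≤ i → i ≤ m → 0 < walk (fun j => (V j ω).1) i}.indicator 1 ω : ℂ) =
      P.indicator 1 (fun i => (V i ω).1) := by
    intro ω
    have : (ω ∈ {ω | ∀ i : ℕ, 1 ≤ i → i ≤ m → 0 < walk (fun j => (V j ω).1) i}) ↔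
        (fun i : Finset.Icc 1 m => (V i ω).1) ∈ P := by
      simp only [hP, Set.mem_ofPred_eq]
      refine forall_congr' fun i => forall_congr' fun _ => forall_congr' fun hi => ?_
      rw [hw ω i hi]
    simp only [Set.indicator_apply, this]
    rfl
  have hqω : ∀ ω (i : Finset.Icc 1 m), q (fun i => (V i ω).1) i =
      ((V i ω).1 : ℝ) / (walk (fun j => (V j ω).1) i : ℝ) := by
    intro ω i
    simp only [hq]
    rw [hw ω i (Finset.mem_Icc.1 i.2).2]
  have := disint μ ν (fun i : Finset.Icc 1 m => V i) (fun i => hmeas i)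
    (hindep.precomp Subtype.val_injective) (fun i => hlaw i) P q (fun d hd i => (hfr d hd i).1)
    (fun d hd i => (hfr d hd i).2) z hz
  simp_rw [hqω, ← hind] at this
  simp_rw [← Finset.prod_coe_sort (Finset.Icc 1 m)]
  exact this

/-- **CLT for the generation in the Poisson branching process conditioned to survive**
(Theorem 3.5(a) of Bhamidi–van der Hofstad–Hooghiemstra): let `D₁, D₂, …` be i.i.d.
Poisson(λ), `λ > 1`, `S_i = Σ_{j≤i} D_j - (i-1)`, and, conditionally on the `D`'s, let
`I₁, …, I_m` be independent Bernoulli(`D_i/S_i`) (realized here through auxiliary independent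
uniforms: `I_i = 1` iff `U_i < D_i/S_i`) and `G_m = Σ_{i≤m} I_i`.  Then, conditionally on
`{S_i > 0 ∀ i ≤ m}`, `(G_m - β log m)/√(β log m) ⇒ N(0,1)` with `β = λ/(λ-1)`. -/
theorem poisson_generation_clt
    (lam : ℝ) (hlam : 1 < lam) (β : ℝ) (hβ : β = lam / (lam - 1))
    (Ω : Type) [MeasurableSpace Ω] (μ : Measure Ω) [IsProbabilityMeasure μ]
    -- `V i = (Dᵢ, Uᵢ)`: the Poisson offspring variable paired with an auxiliary uniform
    (V : ℕ → Ω → ℕ × ℝ)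
    (hmeas : ∀ i, Measurable (V i))
    (hindep : iIndepFun V μ)
    (hlaw : ∀ i, μ.map (V i) = (poissonDist lam).prod uniform01)
    (S : ℕ → Ω → ℤ)
    (hS : ∀ j ω, S j ω = (∑ i ∈ Finset.Icc 1 j, ((V i ω).1 : ℤ)) - ((j : ℤ) - 1))
    -- `I i = 1` iff `U i < D i / S i`, so that conditionally on the `D`'s the `I`'s are
    -- independent Bernoulli(`D_i/S_i`) random variables:
    (I : ℕ → Ω → ℕ)
    (hI : ∀ i ω, I i ω = if (V i ω).2 < ((V i ω).1 : ℝ) / ((S i ω : ℤ) : ℝ) then 1 else 0)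
    (G : ℕ → Ω → ℕ)
    (hG : ∀ m ω, G m ω = ∑ i ∈ Finset.Icc 1 m, I i ω)
    (Pos : ℕ → Set Ω)
    (hPos : ∀ m, Pos m = {ω | ∀ i : ℕ, 1 ≤ i → i ≤ m → 0 < S i ω}) :
    ∀ g : ℝ → ℝ, Continuous g → (∃ C, ∀ x, |g x| ≤ C) →
      Tendsto (fun m : ℕ =>
          ∫ ω, g (((G m ω : ℝ) - β * Real.log m) / Real.sqrt (β * Real.log m))
            ∂(μ[|Pos m]))
        atTop (nhds (∫ x, g x ∂(gaussianReal 0 1))) := by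
  subst hβ
  intro g hg hgb
  obtain ⟨Cg, hCg⟩ := hgb
  have hl0 : 0 < lam := by linarith
  have hl1 : 0 < lam - 1 := by linarith
  obtain ⟨r, hr⟩ : ∃ r : ℝ≥0, (r : ℝ) = lam := ⟨⟨lam, hl0.le⟩, rfl⟩
  have hlaw' : ∀ i, μ.map (V i) = (poissonMeasure r).prod uniform01 := by
    intro i; rw [hlaw, ← hr, poissonDist_eq]
  have hSw : ∀ j ω, S j ω = walk (fun k => (V k ω).1) j := fun j ω => hS j ω
  -- the offspring variables
  have hDm : ∀ i, Measurable (fun ω => (V i ω).1) := fun i => (hmeas i).fst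
  have hDlaw : ∀ i, μ.map (fun ω => (V i ω).1) = poissonMeasure r := by
    intro i
    have : (μ.map (V i)).map Prod.fst = poissonMeasure r := by
      rw [hlaw', Measure.map_fst_prod]; simp
    rw [Measure.map_map measurable_fst (hmeas i)] at this
    exact this
  have hDind : iIndepFun (fun i ω => (V i ω).1) μ := hindep.comp (fun _ => Prod.fst) fun _ => measurable_fst
  set D : ℕ → Ω → ℝ := fun i ω => ((V i ω).1 : ℝ) with hD
  have hDRind : iIndepFun D μ := hDind.comp (fun _ n => (n : ℝ)) fun _ => Measurable.of_discrete
  have hident : ∀ i, IdentDistrib (D i) (D 1) μ μ := by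
    intro i
    have h1 : IdentDistrib (fun ω => (V i ω).1) (fun ω => (V 1 ω).1) μ μ :=
      ⟨(hDm i).aemeasurable, (hDm 1).aemeasurable, by rw [hDlaw, hDlaw]⟩
    exact h1.comp (u := fun n : ℕ => (n : ℝ)) Measurable.of_discrete
  have hDRm : ∀ i, Measurable (D i) := fun i => (Measurable.of_discrete (f := fun n : ℕ => (n : ℝ))).comp (hDm i)
  have hL2 : MemLp (D 1) 2 μ := by
    rw [memLp_two_iff_integrable_sq (hDRm 1).aestronglyMeasurable]
    have := pois_sq r
    rw [← hDlaw 1, integrable_map_measure (Measurable.of_discrete).aestronglyMeasurable (hDm 1).aemeasurable] at this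
    exact this
  have hmean : μ[D 1] = lam := by
    have := pois_mean r
    rw [← hDlaw 1, integral_map (hDm 1).aemeasurable (Measurable.of_discrete).aestronglyMeasurable, hr] at this
    exact this
  have hfacts := as_facts μ D lam hDRind hident hL2 hmean
  set M : ℕ → Ω → ℝ := fun i ω => ∑ j ∈ Finset.Icc 1 i, D j ω - lam * i with hM
  have hSM : ∀ i ω, (S i ω : ℝ) = (lam - 1) * i + 1 + M i ω := by
    intro i ω
    rw [hS]; simp only [hM, hD]; push_cast; ring
  -- survival
  set A : Set Ω := {ω | ∀ i : ℕ, 1 ≤ i → 0 < S i ω} with hA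
  have hApos : 0 < μ A := by
    have := pos_lemma μ (fun i ω => (V i ω).1) hDm hDind ?_ ?_
    · simp only [hA, hS]; exact this
    · intro K
      have h1 : μ.map (fun ω => (V 1 ω).1) {K} = poissonMeasure r {K} := by rw [hDlaw]
      rw [Measure.map_apply (hDm 1) (measurableSet_singleton _), poissonMeasure_singleton] at h1
      refine lt_of_lt_of_le ?_ (measure_mono (s := (fun ω => (V 1 ω).1) ⁻¹' {K}) ?_)
      · rw [h1, ENNReal.ofReal_pos, hr]; positivity
      · intro ω hω
        exact (show (V 1 ω).1 = K from hω).ge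
    · filter_upwards [hfacts] with ω hω
      have := hω.1.eventually_const_le (u := -((lam - 1) / 2)) (by linarith)
      obtain ⟨N, hN⟩ := eventually_atTop.1 this
      refine ⟨(V 1 ω).1 + N, fun i hi => ?_⟩
      rcases le_total N i with h | h
      · have h1 := hN i h
        have hi' : (0 : ℝ) < i := by exact_mod_cast hi
        rw [le_div_iff₀ hi'] at h1
        have h2 : (0 : ℝ) < (S i ω : ℝ) := by
          rw [hSM]; simp only [hM]
          nlinarith
        have h3 : 0 < S i ω := by exact_mod_cast h2
        rw [hS, ← Finset.insert_Icc_succ_left_eq_Icc hi, Finset.sum_insert (by simp)] at h3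
        simp only [Order.succ_eq_add_one, Nat.reduceAdd] at h3
        push_cast
        omega
      · have : 0 ≤ ∑ j ∈ Finset.Icc 2 i, ((V j ω).1 : ℤ) := Finset.sum_nonneg fun _ _ => by positivity
        push_cast
        omega
  -- measurability
  have hSm : ∀ i, Measurable (S i) := by
    intro i
    have : S i = fun ω => (∑ j ∈ Finset.Icc 1 i, ((V j ω).1 : ℤ)) - ((i : ℤ) - 1) := by
      funext ω; exact hS i ω
    rw [this]
    refine Measurable.sub_const (Finset.measurable_fun_sum _ fun j _ => ?_) _
    exact (Measurable.of_discrete (f := fun n : ℕ => (n : ℤ))).comp (hDm j)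
  have hSRm : ∀ i, Measurable fun ω => (S i ω : ℝ) := fun i =>
    (Measurable.of_discrete (f := fun n : ℤ => (n : ℝ))).comp (hSm i)
  have hPosm : ∀ m, MeasurableSet (Pos m) := by
    intro m
    rw [hPos]
    have : {ω | ∀ i : ℕ, 1 ≤ i → i ≤ m → 0 < S i ω} =
        ⋂ i : ℕ, ⋂ (_ : 1 ≤ i), ⋂ (_ : i ≤ m), S i ⁻¹' {x | 0 < x} := by
      ext ω; simp
    rw [this]
    exact MeasurableSet.iInter fun i => MeasurableSet.iInter fun _ => MeasurableSet.iInter fun _ =>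
      hSm i MeasurableSet.of_discrete
  have hAPos : ∀ m, A ⊆ Pos m := by
    intro m ω hω
    rw [hPos]
    exact fun i h1 _ => hω i h1
  have hAm : MeasurableSet A := by
    have : A = ⋂ m, Pos m := by
      ext ω
      simp only [Set.mem_iInter]
      refine ⟨fun h m => hAPos m h, fun h i hi => ?_⟩
      have := h i
      rw [hPos] at this
      exact this i hi le_rfl
    rw [this]
    exact MeasurableSet.iInter hPosm
  have hPpos : ∀ m, μ (Pos m) ≠ 0 := fun m => (hApos.trans_le (measure_mono (hAPos m))).ne'
  have hIm : ∀ i, Measurable (I i) := by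
    intro i
    have : I i = fun ω => if (V i ω).2 < ((V i ω).1 : ℝ) / ((S i ω : ℤ) : ℝ) then 1 else 0 := by
      funext ω; exact hI i ω
    rw [this]
    exact Measurable.ite (measurableSet_lt (hmeas i).snd ((hDRm i).div (hSRm i))) measurable_const measurable_const
  have hGm : ∀ m, Measurable fun ω => (G m ω : ℝ) := by
    intro m
    have : G m = fun ω => ∑ i ∈ Finset.Icc 1 m, I i ω := by funext ω; exact hG m ω
    refine (Measurable.of_discrete (f := fun n : ℕ => (n : ℝ))).comp (g := fun n : ℕ => (n : ℝ)) (f := G m) ?_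
    rw [this]
    exact Finset.measurable_fun_sum _ fun i _ => hIm i
  set L : ℕ → ℝ := fun m => lam / (lam - 1) * Real.log m with hL
  have hLt : Tendsto L atTop atTop :=
    (Real.tendsto_log_atTop.comp tendsto_natCast_atTop_atTop).const_mul_atTop (by positivity)
  set X : ℕ → Ω → ℝ := fun m ω => ((G m ω : ℝ) - L m) / √(L m) with hX
  have hXm : ∀ m, Measurable (X m) := fun m => ((hGm m).sub_const _).div_const _
  -- pointwise convergence of the conditional characteristic functions
  set Φ : ℝ → ℕ → Ω → ℂ := fun t m ω => (Pos m).indicator 1 ω *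
    (Complex.exp (((-(t / √(L m) * L m) : ℝ) : ℂ) * Complex.I) *
      ∏ i ∈ Finset.Icc 1 m, (1 + ((D i ω / (S i ω : ℝ) : ℝ) : ℂ) *
        (Complex.exp (((t / √(L m) : ℝ) : ℂ) * Complex.I) - 1))) with hΦ
  have hΦlim : ∀ t, ∀ᵐ ω ∂μ, Tendsto (fun m => Φ t m ω) atTop
      (nhds (A.indicator 1 ω * Complex.exp (-(t : ℂ) ^ 2 / 2))) := by
    intro t
    filter_upwards [hfacts] with ω hω
    by_cases hωA : ω ∈ A
    · obtain ⟨C, hC1, hC2⟩ := det_sums lam hlam (fun i => D i ω) (fun i => (S i ω : ℝ)) (fun i => M i ω)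
        (by simp [hM]) (by
          intro i hi
          obtain ⟨n, rfl⟩ : ∃ n, i = n + 1 := ⟨i - 1, by omega⟩
          simp only [hM, Nat.add_sub_cancel]
          rw [Finset.sum_Icc_succ_top (by omega)]
          push_cast; ring)
        (fun i => hSM i ω) (fun i hi => by exact_mod_cast hωA i hi) hω.1 hω.2.1 hω.2.2
      have hfr : ∀ i : ℕ, 1 ≤ i → 0 ≤ D i ω / (S i ω : ℝ) ∧ D i ω / (S i ω : ℝ) ≤ 1 := by
        intro i hi
        have := walk_frac (fun k => (V k ω).1) i
          (fun k hk _ => by rw [← hSw]; exact hωA k hk) i hi le_rfl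
        rw [← hSw] at this
        exact this
      have := clt_det (fun i => D i ω / (S i ω : ℝ)) L C t hLt (fun i hi => (hfr i hi).1)
        (fun i hi => (hfr i hi).2) hC1 hC2
      simp only [hΦ]
      have hin : ∀ m, ((Pos m).indicator 1 ω : ℂ) = 1 := fun m => by
        rw [Set.indicator_of_mem (hAPos m hωA)]; rfl
      simp_rw [hin, one_mul]
      rw [Set.indicator_of_mem hωA]
      simpa only [Pi.one_apply, one_mul] using this
    · rw [Set.indicator_of_notMem hωA, zero_mul]
      have : ∃ i : ℕ, 1 ≤ i ∧ ¬ 0 < S i ω := by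
        by_contra! h
        exact hωA h
      obtain ⟨i, hi1, hi2⟩ := this
      refine tendsto_const_nhds.congr' ?_
      filter_upwards [eventually_ge_atTop i] with m hm
      have : ω ∉ Pos m := by
        rw [hPos]; intro h; exact hi2 (h i hi1 hm)
      simp only [hΦ]
      rw [Set.indicator_of_notMem this, zero_mul]
  have hΦb : ∀ t m ω, ‖Φ t m ω‖ ≤ 1 := by
    intro t m ω
    simp only [hΦ]
    by_cases h : ω ∈ Pos m
    · rw [Set.indicator_of_mem h, Pi.one_apply, one_mul, norm_mul, Complex.norm_exp_ofReal_mul_I,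
        one_mul, norm_prod]
      refine Finset.prod_le_one (fun _ _ => norm_nonneg _) fun i hi => ?_
      rw [Finset.mem_Icc] at hi
      have h' := h
      rw [hPos] at h'
      have := walk_frac (fun k => (V k ω).1) m
          (fun k hk hk2 => by rw [← hSw]; exact h' k hk hk2) i hi.1 hi.2
      rw [← hSw] at this
      exact aux_norm_le _ _ this.1 this.2
    · rw [Set.indicator_of_notMem h]; simp
  have hΦm : ∀ t m, Measurable (Φ t m) := by
    intro t m
    refine Measurable.mul (measurable_one.indicator (hPosm m)) (Measurable.const_mul ?_ _)
    refine Finset.measurable_fun_prod _ fun i _ => ?_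
    exact ((Complex.measurable_ofReal.comp ((hDRm i).div (hSRm i))).mul_const _).const_add _
  have hΦint : ∀ t, Tendsto (fun m => ∫ ω, Φ t m ω ∂μ) atTop
      (nhds (∫ ω, A.indicator 1 ω * Complex.exp (-(t : ℂ) ^ 2 / 2) ∂μ)) := fun t =>
    tendsto_integral_of_dominated_convergence (fun _ => 1)
      (fun m => (hΦm t m).aestronglyMeasurable) (integrable_const _)
      (fun m => ae_of_all _ (hΦb t m)) (hΦlim t)
  have hlimval : ∀ t : ℝ, ∫ ω, A.indicator 1 ω * Complex.exp (-(t : ℂ) ^ 2 / 2) ∂μ =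
      μ.real A * Complex.exp (-(t : ℂ) ^ 2 / 2) := by
    intro t
    rw [integral_mul_const, integral_indicator hAm]
    simp
  -- masses
  have hmass : Tendsto (fun m => μ.real (Pos m)) atTop (nhds (μ.real A)) := by
    have hAe : A = ⋂ m, Pos m := by
      ext ω
      simp only [Set.mem_iInter]
      refine ⟨fun h m => hAPos m h, fun h i hi => ?_⟩
      have := h i
      rw [hPos] at this
      exact this i hi le_rfl
    have hanti : Antitone Pos := by
      intro m n hmn ω hω
      rw [hPos] at hω ⊢
      exact fun i h1 h2 => hω i h1 (h2.trans hmn)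
    have := tendsto_measure_iInter_atTop (μ := μ) (fun m => (hPosm m).nullMeasurableSet) hanti
      ⟨0, measure_ne_top _ _⟩
    rw [← hAe] at this
    exact (ENNReal.tendsto_toReal (measure_ne_top _ _)).comp this
  have hAr : μ.real A ≠ 0 := (ENNReal.toReal_pos hApos.ne' (measure_ne_top _ _)).ne'
  have hcf : ∀ (t : ℝ) m, charFun ((μ[|Pos m]).map (X m)) t = (μ.real (Pos m) : ℂ)⁻¹ * ∫ ω, Φ t m ω ∂μ := by
    intro t m
    rw [charFun_apply_real, integral_map (hXm m).aemeasurable (by fun_prop)]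
    rw [ProbabilityTheory.cond, integral_smul_measure, ENNReal.toReal_inv, Complex.real_smul,
      Complex.ofReal_inv]
    congr 1
    rw [← integral_indicator (hPosm m)]
    have hk := key_id μ (poissonMeasure r) V hmeas hindep hlaw' m
      (Complex.exp (((t / √(L m) : ℝ) : ℂ) * Complex.I)) (Complex.norm_exp_ofReal_mul_I _).le
    simp_rw [← hSw] at hk
    rw [← hPos] at hk
    have hk2 := congrArg (fun x => Complex.exp (((-(t / √(L m) * L m) : ℝ) : ℂ) * Complex.I) * x) hk
    simp only [← integral_const_mul] at hk2
    have e1 : ∀ ω, Φ t m ω = Complex.exp (((-(t / √(L m) * L m) : ℝ) : ℂ) * Complex.I) * 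
        ((Pos m).indicator 1 ω * ∏ i ∈ Finset.Icc 1 m, (1 + (((V i ω).1 / (S i ω : ℝ) : ℝ) : ℂ) *
        (Complex.exp (((t / √(L m) : ℝ) : ℂ) * Complex.I) - 1))) := by
      intro ω; simp only [hΦ, hD]; ring
    simp_rw [e1]
    rw [← hk2]
    congr 1
    funext ω
    by_cases h : ω ∈ Pos m
    · rw [Set.indicator_of_mem h, Set.indicator_of_mem h, Pi.one_apply, one_mul]
      have e2 : ∀ i, (if (V i ω).2 < ((V i ω).1 : ℝ) / ((S i ω : ℤ) : ℝ) then
          Complex.exp (((t / √(L m) : ℝ) : ℂ) * Complex.I) else 1) =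
          Complex.exp ((I i ω : ℂ) * (((t / √(L m) : ℝ) : ℂ) * Complex.I)) := by
        intro i
        rw [hI]
        split_ifs <;> simp
      simp_rw [e2]
      rw [← Complex.exp_sum, ← Complex.exp_add, ← Finset.sum_mul]
      congr 1
      simp only [hX]
      rw [hG]
      push_cast
      ring
    · rw [Set.indicator_of_notMem h, Set.indicator_of_notMem h]; simp
  have hprob : ∀ m, IsProbabilityMeasure (μ[|Pos m]) := fun m => cond_isProbabilityMeasure (hPpos m)
  have hprob2 : ∀ m, IsProbabilityMeasure ((μ[|Pos m]).map (X m)) := fun m =>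
    Measure.isProbabilityMeasure_map (hXm m).aemeasurable
  obtain ⟨ν, hν⟩ : ∃ ν : ℕ → ProbabilityMeasure ℝ,
      ∀ m, (ν m : Measure ℝ) = (μ[|Pos m]).map (X m) := ⟨fun m => ⟨_, hprob2 m⟩, fun _ => rfl⟩
  obtain ⟨ν0, hν0⟩ : ∃ ν0 : ProbabilityMeasure ℝ, (ν0 : Measure ℝ) = gaussianReal 0 1 :=
    ⟨⟨gaussianReal 0 1, inferInstance⟩, rfl⟩
  have hconv : Tendsto ν atTop (nhds ν0) := by
    rw [ProbabilityMeasure.tendsto_iff_tendsto_charFun]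
    intro t
    simp only [hν, hν0, hcf, charFun_gaussianReal]
    have h1 : Tendsto (fun m => (μ.real (Pos m) : ℂ)⁻¹) atTop (nhds ((μ.real A : ℂ)⁻¹)) :=
      ((Complex.continuous_ofReal.tendsto _).comp hmass).inv₀ (by exact_mod_cast hAr)
    have h2 := h1.mul (hΦint t)
    rw [hlimval, ← mul_assoc, inv_mul_cancel₀ (by exact_mod_cast hAr), one_mul] at h2
    convert h2 using 2
    congr 1
    simp
    ring
  have hfin := ProbabilityMeasure.tendsto_iff_forall_integral_tendsto.1 hconv
    (BoundedContinuousFunction.ofNormedAddCommGroup g hg Cg hCg)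
  simp only [hν, hν0, BoundedContinuousFunction.coe_ofNormedAddCommGroup] at hfin
  refine hfin.congr fun m => ?_
  rw [integral_map (hXm m).aemeasurable hg.aestronglyMeasurable]

end
end

section
/- Let λ > 1, let D_1, D_2, … be i.i.d. Poisson(λ) random variables, and set S_j = (Σ_{i=1}^j D_i) − (j−1). There exists a constant C > 0 (depending only on λ) such that P( for all j with log log m < j ≤ m : (λ−1)j − C√(j·log j) ≤ S_j ≤ (λ−1)j + C√(j·log j) ) → 1 as m → ∞. -/
open MeasureTheory ProbabilityTheory Filter Real
open scoped ENNReal NNReal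

noncomputable section

lemma poissonDist_eq_s10 (l : ℝ) (hl : 0 ≤ l) : poissonDist l = poissonMeasure l.toNNReal := by
  refine Measure.ext_of_singleton fun n => ?_
  rw [poissonMeasure_singleton, poissonDist, withDensity_apply _ (measurableSet_singleton n)]
  simp [Real.coe_toNNReal l hl]

lemma poisson_exp_hasSum (l t : ℝ) :
    HasSum (fun n : ℕ => Real.exp (-l) * l ^ n / n.factorial * Real.exp (t * n))
      (Real.exp (l * (Real.exp t - 1))) := by
  have h := (NormedSpace.expSeries_div_hasSum_exp (l * Real.exp t)).mul_left (Real.exp (-l))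
  rw [← Real.exp_eq_exp_ℝ, ← Real.exp_add] at h
  have e1 : (fun n : ℕ => Real.exp (-l) * l ^ n / n.factorial * Real.exp (t * n)) =
      fun n : ℕ => Real.exp (-l) * ((l * Real.exp t) ^ n / n.factorial) := by
    funext n
    rw [mul_pow, ← Real.exp_nat_mul, mul_comm t]
    ring
  have e2 : l * (Real.exp t - 1) = -l + l * Real.exp t := by ring
  rw [e1, e2]
  exact h

lemma poisson_mgf {l : ℝ} (hl : 0 ≤ l) {Ω : Type} [MeasurableSpace Ω] (μ : Measure Ω)
    (D : Ω → ℕ) (hD : Measurable D) (hlaw : μ.map D = poissonDist l) (t : ℝ) :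
    Integrable (fun ω => Real.exp (t * (D ω : ℝ))) μ ∧
      mgf (fun ω => (D ω : ℝ)) μ t = Real.exp (l * (Real.exp t - 1)) := by
  have hi : Integrable (fun n : ℕ => Real.exp (t * n)) (μ.map D) := by
    rw [hlaw, poissonDist_eq_s10 l hl, integrable_poissonMeasure_iff]
    simpa [Real.coe_toNNReal l hl] using (poisson_exp_hasSum l t).summable
  refine ⟨hi.comp_measurable hD, ?_⟩
  have h2 : ∫ n : ℕ, Real.exp (t * n) ∂(μ.map D) = Real.exp (l * (Real.exp t - 1)) := by
    rw [hlaw, poissonDist_eq_s10 l hl, integral_poissonMeasure]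
    simpa [Real.coe_toNNReal l hl] using (poisson_exp_hasSum l t).tsum_eq
  rw [integral_map hD.aemeasurable .of_discrete] at h2
  exact h2

lemma poisson_chernoff {l : ℝ} (hl : 0 ≤ l) {Ω : Type} [MeasurableSpace Ω] (μ : Measure Ω)
    [IsProbabilityMeasure μ] (D : ℕ → Ω → ℕ) (hD : ∀ i, Measurable (D i))
    (hindep : iIndepFun D μ)
    (hlaw : ∀ i, μ.map (D i) = poissonDist l) (j : ℕ) (hj : 3 ≤ j) :
    μ {ω | (l + 2) * √(j * Real.log j) ≤ |(∑ i ∈ Finset.Icc 1 j, (D i ω : ℝ)) - l * j|}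
      ≤ ENNReal.ofReal (2 * (1 / (j : ℝ) ^ 2)) := by
  have hj0 : (0 : ℝ) < j := by positivity
  have hj1 : (1 : ℝ) ≤ j := by exact_mod_cast (by omega : 1 ≤ j)
  have hlog : 0 ≤ Real.log j := Real.log_nonneg hj1
  set t := √(Real.log j / j) with ht
  have ht0 : 0 ≤ t := Real.sqrt_nonneg _
  have ht1 : t ≤ 1 := by
    refine Real.sqrt_le_one.2 ((div_le_one hj0).2 ?_)
    exact Real.log_le_self hj0.le
  have htt : j * t ^ 2 = Real.log j := by
    rw [ht, Real.sq_sqrt (by positivity)]; field_simp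
  have hr : √(j * Real.log j) = j * t := by
    rw [Real.sqrt_eq_iff_mul_self_eq (by positivity) (by positivity), ← htt]; ring
  have hind : iIndepFun (fun i ω => (D i ω : ℝ)) μ :=
    hindep.comp (fun _ n => (n : ℝ)) (fun _ => .of_discrete)
  have hm : ∀ i, Measurable (fun ω => (D i ω : ℝ)) := fun i =>
    (Measurable.of_discrete (f := fun n : ℕ => (n : ℝ))).comp (hD i)
  have hint : ∀ s : ℝ, Integrable
      (fun ω => Real.exp (s * (∑ i ∈ Finset.Icc 1 j, (fun ω => (D i ω : ℝ))) ω)) μ := fun s =>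
    hind.integrable_exp_mul_sum hm (fun i _ => (poisson_mgf hl μ (D i) (hD i) (hlaw i) s).1)
  have hmgf : ∀ s : ℝ, |s| ≤ 1 → mgf (∑ i ∈ Finset.Icc 1 j, (fun ω => (D i ω : ℝ))) μ s
      ≤ Real.exp (j * l * (s + s ^ 2)) := by
    intro s hs
    rw [hind.mgf_sum hm]
    simp_rw [fun i => (poisson_mgf hl μ (D i) (hD i) (hlaw i) s).2]
    rw [Finset.prod_const, ← Real.exp_nat_mul]
    simp only [Nat.card_Icc, Nat.add_sub_cancel]
    rw [Real.exp_le_exp, ← mul_assoc]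
    gcongr
    have := (abs_le.1 (Real.abs_exp_sub_one_sub_id_le hs)).2
    linarith
  have hexp : Real.exp (-2 * Real.log j) = 1 / (j : ℝ) ^ 2 := by
    rw [neg_mul, Real.exp_neg, ← Real.rpow_natCast, Real.rpow_def_of_pos hj0]
    simp [mul_comm]
  have h1 := measure_ge_le_exp_mul_mgf (μ := μ) (l * j + (l + 2) * (j * t)) ht0 (hint t)
  have h2 := measure_le_le_exp_mul_mgf (μ := μ) (l * j - (l + 2) * (j * t))
    (neg_nonpos.2 ht0) (hint (-t))
  have h1' : μ.real {ω | l * j + (l + 2) * (j * t) ≤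
      (∑ i ∈ Finset.Icc 1 j, (fun ω => (D i ω : ℝ))) ω} ≤ 1 / (j : ℝ) ^ 2 := by
    refine h1.trans ((mul_le_mul_of_nonneg_left (hmgf t (by rwa [abs_of_nonneg ht0]))
      (Real.exp_pos _).le).trans ?_)
    rw [← Real.exp_add, ← hexp, ← htt]
    apply le_of_eq; congr 1; ring
  have h2' : μ.real {ω | (∑ i ∈ Finset.Icc 1 j, (fun ω => (D i ω : ℝ))) ω ≤
      l * j - (l + 2) * (j * t)} ≤ 1 / (j : ℝ) ^ 2 := by
    refine h2.trans ((mul_le_mul_of_nonneg_left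
      (hmgf (-t) (by rwa [abs_neg, abs_of_nonneg ht0])) (Real.exp_pos _).le).trans ?_)
    rw [← Real.exp_add, ← hexp, ← htt]
    apply le_of_eq; congr 1; ring
  rw [← ofReal_measureReal]
  apply ENNReal.ofReal_le_ofReal
  rw [two_mul]
  refine le_trans ?_ ((measureReal_union_le _ _).trans (add_le_add h1' h2'))
  refine measureReal_mono ?_
  intro ω hω
  simp only [Set.mem_ofPred_eq, hr, Set.mem_union, Finset.sum_apply] at hω ⊢
  rcases le_abs.1 hω with h | h
  · left; linarith
  · right; linarith

/-- **Good bounds for the Poisson random walk** (Proposition 3.6(b) of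
Bhamidi–van der Hofstad–Hooghiemstra): for `D₁, D₂, …` i.i.d. Poisson(λ), `λ > 1`, and
`S_j = Σ_{i≤j} D_i - (j-1)`, there is a constant `C > 0` such that with probability tending
to `1` as `m → ∞`, for all `log log m < j ≤ m` one has
`(λ-1)j - C√(j log j) ≤ S_j ≤ (λ-1)j + C√(j log j)`. -/
theorem poisson_walk_good_bounds
    (lam : ℝ) (hlam : 1 < lam)
    (Ω : Type) [MeasurableSpace Ω] (μ : Measure Ω) [IsProbabilityMeasure μ]
    (D : ℕ → Ω → ℕ)
    (hmeas : ∀ i, Measurable (D i))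
    (hindep : iIndepFun D μ)
    (hlaw : ∀ i, μ.map (D i) = poissonDist lam)
    (S : ℕ → Ω → ℤ)
    (hS : ∀ j ω, S j ω = (∑ i ∈ Finset.Icc 1 j, (D i ω : ℤ)) - ((j : ℤ) - 1)) :
    ∃ C : ℝ, 0 < C ∧
      Tendsto (fun m : ℕ =>
          μ {ω | ∀ j : ℕ, Real.log (Real.log m) < (j : ℝ) → j ≤ m →
            ((lam - 1) * j - C * Real.sqrt (j * Real.log j) ≤ (S j ω : ℝ) ∧
              (S j ω : ℝ) ≤ (lam - 1) * j + C * Real.sqrt (j * Real.log j))})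
        atTop (nhds 1) := by
  have hl0 : 0 ≤ lam := by linarith
  refine ⟨lam + 3, by linarith, ?_⟩
  set G : ℕ → Set Ω := fun j => {ω | (lam - 1) * j - (lam + 3) * √(j * Real.log j) ≤ (S j ω : ℝ) ∧
              (S j ω : ℝ) ≤ (lam - 1) * j + (lam + 3) * √(j * Real.log j)} with hG
  set B : ℕ → Set Ω := fun j => {ω | 3 ≤ j ∧
    (lam + 2) * √(j * Real.log j) ≤ |(∑ i ∈ Finset.Icc 1 j, (D i ω : ℝ)) - lam * j|} with hB
  have hBm : ∀ j, μ (B j) ≤ ENNReal.ofReal (2 * (1 / (j : ℝ) ^ 2)) := by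
    intro j
    by_cases hj : 3 ≤ j
    · refine (measure_mono ?_).trans (poisson_chernoff hl0 μ D hmeas hindep hlaw j hj)
      exact fun ω hω => hω.2
    · simp [hB, hj]
  have hsum : (∑' j, μ (B j)) ≠ ∞ := by
    refine ne_top_of_le_ne_top ?_ (ENNReal.tsum_le_tsum hBm)
    exact ((Real.summable_one_div_nat_pow.2 one_lt_two).mul_left 2).tsum_ofReal_ne_top
  have hBG : ∀ j ω, 3 ≤ j → ω ∉ B j → ω ∈ G j := by
    intro j ω hj hω
    have hj3 : (3 : ℝ) ≤ j := by exact_mod_cast hj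
    have hlog : 1 ≤ Real.log j := by
      rw [Real.le_log_iff_exp_le (by linarith)]
      linarith [Real.exp_one_lt_d9]
    have h1 : 1 ≤ √(j * Real.log j) := by
      rw [Real.one_le_sqrt]; nlinarith
    simp only [hB, Set.mem_ofPred_eq, hj, true_and, not_le] at hω
    have h2 := abs_lt.1 hω
    simp only [hG, Set.mem_ofPred_eq, hS]
    push_cast
    constructor <;> nlinarith [h2.1, h2.2]
  set E : ℕ → Set Ω := fun N => {ω | ∀ j, N ≤ j → ω ∈ G j} with hE
  have hmono : Monotone E := fun a b hab ω hω j hj => hω j (hab.trans hj)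
  have hU : μ (⋃ N, E N) = 1 := by
    have h : ∀ᵐ ω ∂μ, ω ∈ ⋃ N, E N := by
      filter_upwards [ae_eventually_notMem hsum] with ω hω
      obtain ⟨N, hN⟩ := eventually_atTop.1 hω
      refine Set.mem_iUnion.2 ⟨max N 3, fun j hj => hBG j ω ?_ (hN j ?_)⟩
      · exact (le_max_right _ _).trans hj
      · exact (le_max_left _ _).trans hj
    exact ((measure_congr (eventuallyEq_univ.2 h : (⋃ N, E N) =ᵐ[μ] Set.univ)).trans measure_univ)
  have hT := tendsto_measure_iUnion_atTop (μ := μ) hmono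
  rw [hU] at hT
  have hN : Tendsto (fun m : ℕ => ⌈Real.log (Real.log m)⌉₊) atTop atTop :=
    tendsto_nat_ceil_atTop.comp (Real.tendsto_log_atTop.comp
      (Real.tendsto_log_atTop.comp tendsto_natCast_atTop_atTop))
  refine tendsto_of_tendsto_of_tendsto_of_le_of_le (hT.comp hN) tendsto_const_nhds ?_ ?_
  · intro m
    refine measure_mono ?_
    intro ω hω j hj _
    exact hω j (Nat.ceil_le.2 hj.le)
  · intro m
    exact prob_le_one

end
end
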